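/- arXiv:1111.3061 — 2 statements merged into one kernel-verified Lean document; each statement's English description precedes it below -/
import Mathlib

section
/- The polynomials p_n(N) = Σ_{g=0}^{⌊n/2⌋} H(n, n+1−2g)·N^{n+1−2g} satisfy, for every n ≥ 2, the recursion (n+2)·p_n(N) = (2n+1)·N·p_{n−1}(N) + (n−1)·(n² − N²)·p_{n−2}(N), as an identity of polynomials in N (equivalently, for every integer value of N), with initial values p_0(N) = N and p_1(N) = N². -/
/-- The permutation of `ZMod (n+1)` fixing `0` and acting as `π` on `{1,…,n}`
(the element `i+1` of `ZMod (n+1)` corresponding to `i : Fin n`). -/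
def pihat {n : ℕ} (π : Equiv.Perm (Fin n)) : Equiv.Perm (ZMod (n+1)) :=
  Equiv.Perm.decomposeFin.symm (0, π)

/-- The permutation `v ↦ π̂ (π̂⁻¹ (v+1) - 1)` of `ZMod (n+1)`, whose orbits are the
alternating cycles of the cycle graph of `π`. -/
def cpi {n : ℕ} (π : Equiv.Perm (Fin n)) : Equiv.Perm (ZMod (n+1)) :=
  (Equiv.addRight (1 : ZMod (n+1))).trans
    ((pihat π).symm.trans ((Equiv.subRight (1 : ZMod (n+1))).trans (pihat π)))

/-- `A n π` is the number of alternating cycles of the cycle graph of `π`: the number of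
orbits of the cyclic group generated by `cpi π` acting on `ZMod (n+1)`. -/
noncomputable def A (n : ℕ) (π : Equiv.Perm (Fin n)) : ℕ :=
  Nat.card (MulAction.orbitRel.Quotient (Subgroup.zpowers (cpi π)) (ZMod (n+1)))

/-- The Hultman number `H n k`: the number of permutations of `Fin n` whose cycle graph
has exactly `k` alternating cycles. -/
noncomputable def H (n k : ℕ) : ℕ := Nat.card {π : Equiv.Perm (Fin n) // A n π = k}

/-- The Hultman polynomial `p_n(N) = Σ_{g=0}^{⌊n/2⌋} H(n, n+1-2g) N^{n+1-2g}`,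
evaluated at an integer `N`. -/
noncomputable def p (n : ℕ) (N : ℤ) : ℤ :=
  ∑ g ∈ Finset.range (n / 2 + 1), (H n (n + 1 - 2 * g) : ℤ) * N ^ (n + 1 - 2 * g)


open Equiv in
noncomputable def Zc (N : ℕ) {X : Type} (α : Perm X) : ℤ :=
  (Nat.card {f : X → ZMod N // ∀ v, f (α v) = f v} : ℤ)

section
open Equiv Finset

variable {N : ℕ} {X Y : Type}

theorem Zc_congr (e : X ≃ Y) (α : Perm X) (β : Perm Y) (h : ∀ v, e (α v) = β (e v)) :
    Zc N α = Zc N β := by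
  unfold Zc
  congr 1
  refine Nat.card_congr ((Equiv.arrowCongr e (Equiv.refl _)).subtypeEquiv ?_)
  intro f
  constructor
  · intro hf v
    have := hf (e.symm v)
    have h2 := h (e.symm v)
    simp only [apply_symm_apply] at h2
    simp [Equiv.arrowCongr, ← h2, this]
  · intro hf v
    have := hf (e v)
    rw [← h] at this
    simpa [Equiv.arrowCongr] using this

theorem Zc_comm (α β : Perm X) : Zc N (α * β) = Zc N (β * α) :=
  Zc_congr β _ _ (by intro v; simp)

theorem Zc_swap [NeZero N] [Fintype X] [DecidableEq X] (W : Finset X) (α : Perm X)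
    (hα : ∀ v, α v ∈ W ↔ v ∈ W) {x y : X} (hx : x ∈ W) (hy : y ∉ W) :
    (N : ℤ) * Zc N (swap x y * α) = Zc N α := by
  have key : ∀ f : X → ZMod N, (∀ v, f ((swap x y * α) v) = f v) ↔
      ((∀ v, f (α v) = f v) ∧ f x = f y) := by
    intro f
    constructor
    · intro h
      have h1 : ∑ v ∈ W, f v = ∑ v ∈ W, f (swap x y v) := by
        calc ∑ v ∈ W, f v = ∑ v ∈ W, f (swap x y (α v)) := by
              refine Finset.sum_congr rfl fun v _ => ?_
              rw [← h v]; rfl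
          _ = _ := by
              refine Finset.sum_bij (fun v _ => α v) ?_ ?_ ?_ ?_
              · intro v hv; exact (hα v).2 hv
              · intro a _ b _ hab; exact α.injective hab
              · intro b hb
                exact ⟨α.symm b, by rw [← hα]; simpa using hb, by simp⟩
              · intro v _; rfl
      rw [← Finset.add_sum_erase _ _ hx, ← Finset.add_sum_erase _ _ hx] at h1
      have h2 : ∑ v ∈ W.erase x, f (swap x y v) = ∑ v ∈ W.erase x, f v := by
        refine Finset.sum_congr rfl fun v hv => ?_
        rw [Finset.mem_erase] at hv
        rw [swap_apply_of_ne_of_ne hv.1]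
        rintro rfl; exact hy hv.2
      rw [h2] at h1
      have hxy : f x = f y := by simpa using h1
      refine ⟨fun v => ?_, hxy⟩
      rw [← h v]
      simp only [Perm.coe_mul, Function.comp_apply]
      rw [swap_apply_def]; split_ifs with h3 h4
      · rw [h3, hxy]
      · rw [h4, hxy]
      · rfl
    · rintro ⟨h, hxy⟩ v
      rw [← h v]
      simp only [Perm.coe_mul, Function.comp_apply]
      rw [swap_apply_def]; split_ifs with h3 h4
      · rw [h3, hxy]
      · rw [h4, hxy]
      · rfl
  unfold Zc
  simp only [key]
  have hh : ∀ S : Type, N * Nat.card S = Nat.card (ZMod N × S) := fun S => by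
    rw [Nat.card_prod, Nat.card_zmod]
  norm_cast
  rw [hh]
  refine Nat.card_congr ?_
  refine
    { toFun := fun q => ⟨fun v => q.2.1 v + if v ∈ W then q.1 else 0, ?_⟩
      invFun := fun f => (f.1 x - f.1 y, ⟨fun v => f.1 v - if v ∈ W then (f.1 x - f.1 y) else 0, ?_, ?_⟩)
      left_inv := ?_
      right_inv := ?_ }
  · intro v; simp only [hα, q.2.2.1]
  · intro v; simp only [hα, f.2 v]
  · simp [hx, hy]
  · rintro ⟨c, f, hf, hxy⟩
    have : f x + c - f y = c := by rw [hxy]; ring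
    simp [hx, hy, this]
  · rintro ⟨f, hf⟩
    simp

theorem Zc_decomp [NeZero N] {n : ℕ} (q : Fin (n+1)) (e : Perm (Fin n)) :
    Zc N (Perm.decomposeFin.symm (q, e)) = (if q = 0 then (N : ℤ) else 1) * Zc N e := by
  have h0 : Zc N (Perm.decomposeFin.symm ((0 : Fin (n+1)), e)) = (N : ℤ) * Zc N e := by
    unfold Zc
    have hh : ∀ S : Type, N * Nat.card S = Nat.card (ZMod N × S) := fun S => by
      rw [Nat.card_prod, Nat.card_zmod]
    norm_cast
    rw [hh]
    refine Nat.card_congr ?_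
    refine
    { toFun := fun f => (f.1 0, ⟨fun v => f.1 v.succ, ?_⟩)
      invFun := fun f => ⟨Fin.cons f.1 f.2.1, ?_⟩
      left_inv := ?_
      right_inv := ?_ }
    · intro v
      have := f.2 v.succ
      simpa using this
    · intro v
      refine Fin.cases ?_ (fun i => ?_) v
      · simp
      · simp [f.2.2 i]
    · rintro ⟨f, hf⟩
      ext v
      refine Fin.cases ?_ (fun i => ?_) v <;> simp
    · rintro ⟨c, f, hf⟩
      simp
  split_ifs with hq
  · rw [hq, h0]
  · have h1 : Perm.decomposeFin.symm (q, e) = swap 0 q * Perm.decomposeFin.symm ((0 : Fin (n+1)), e) := by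
      ext v
      refine Fin.cases ?_ (fun i => ?_) v <;> simp
    have h2 := Zc_swap (N := N) ({0} : Finset (Fin (n+1))) (Perm.decomposeFin.symm ((0 : Fin (n+1)), e))
      (by
        intro v
        refine Fin.cases ?_ (fun i => ?_) v <;> simp) (x := 0) (y := q) (by simp) (by simpa using hq)
    rw [← h1, h0] at h2
    have : (N : ℤ) ≠ 0 := by exact_mod_cast NeZero.ne N
    rw [one_mul]
    exact mul_left_cancel₀ this h2

theorem Zc_zero (e : Perm (Fin 0)) : Zc N e = 1 := by
  unfold Zc
  have : Unique {f : Fin 0 → ZMod N // ∀ v, f (e v) = f v} :=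
    { default := ⟨fun v => v.elim0, fun v => v.elim0⟩
      uniq := fun a => by ext v; exact v.elim0 }
  simp

theorem Zc_pow {n : ℕ} (e : Perm (Fin n)) :
    ∃ c : ℕ, c ≤ n ∧ (∀ N : ℕ, N ≠ 0 → Zc N e = (N:ℤ)^c) ∧ (Perm.sign e : ℤ) = (-1)^(n+c) := by
  induction n with
  | zero => exact ⟨0, le_rfl, fun N _ => by simp [Zc_zero], by
      have : e = 1 := Subsingleton.elim _ _
      simp [this]⟩
  | succ n ih =>
    obtain ⟨⟨q, e⟩, rfl⟩ := Perm.decomposeFin.symm.surjective e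
    obtain ⟨c, hc, h1, h2⟩ := ih e
    by_cases hq : q = 0
    · refine ⟨c+1, by omega, ?_, ?_⟩
      · intro N hN
        have : NeZero N := ⟨hN⟩
        rw [Zc_decomp, h1 N hN]; simp [hq]; ring
      · rw [Perm.decomposeFin.symm_sign]; simp [hq, h2]; ring
    · refine ⟨c, by omega, ?_, ?_⟩
      · intro N hN
        have : NeZero N := ⟨hN⟩
        rw [Zc_decomp, h1 N hN]; simp [hq]
      · rw [Perm.decomposeFin.symm_sign]; simp [hq, h2]; ring

theorem sum_Zc_fin [NeZero N] (n : ℕ) :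
    ∑ e : Perm (Fin n), Zc N e = ∏ i ∈ range n, ((N:ℤ) + i) := by
  induction n with
  | zero => simp [Zc_zero]
  | succ n ih =>
    rw [← Equiv.sum_comp Perm.decomposeFin.symm, Fintype.sum_prod_type]
    simp_rw [Zc_decomp, ← Finset.mul_sum, ih, ← Finset.sum_mul]
    rw [Finset.prod_range_succ, mul_comm, Fin.sum_univ_succ]
    simp [Fin.succ_ne_zero]

theorem sum_sign_Zc_fin [NeZero N] (n : ℕ) :
    ∑ e : Perm (Fin n), (Perm.sign e : ℤ) * Zc N e = ∏ i ∈ range n, ((N:ℤ) - i) := by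
  induction n with
  | zero => simp [Zc_zero]
  | succ n ih =>
    rw [← Equiv.sum_comp Perm.decomposeFin.symm, Fintype.sum_prod_type]
    have : ∀ (q : Fin (n+1)) (e : Perm (Fin n)), (Perm.sign (Perm.decomposeFin.symm (q, e)) : ℤ) * Zc N (Perm.decomposeFin.symm (q, e)) = (if q = 0 then (N:ℤ) else -1) * ((Perm.sign e : ℤ) * Zc N e) := by
      intro q e
      rw [Zc_decomp, Perm.decomposeFin.symm_sign]
      split_ifs <;> simp; ring
    simp_rw [this, ← Finset.mul_sum, ih, ← Finset.sum_mul]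
    rw [Finset.prod_range_succ, mul_comm, Fin.sum_univ_succ]
    simp [Fin.succ_ne_zero]
    ring_nf
    try simp

theorem sum_Zc [NeZero N] [Fintype X] [DecidableEq X] :
    ∑ e : Perm X, Zc N e = ∏ i ∈ range (Fintype.card X), ((N:ℤ) + i) := by
  rw [← sum_Zc_fin, ← Equiv.sum_comp (Fintype.equivFin X).permCongr]
  exact Finset.sum_congr rfl fun e _ => Zc_congr (Fintype.equivFin X) _ _ (by simp)

theorem sum_sign_Zc [NeZero N] [Fintype X] [DecidableEq X] :
    ∑ e : Perm X, (Perm.sign e : ℤ) * Zc N e = ∏ i ∈ range (Fintype.card X), ((N:ℤ) - i) := by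
  rw [← sum_sign_Zc_fin, ← Equiv.sum_comp (Fintype.equivFin X).permCongr]
  refine Finset.sum_congr rfl fun e _ => ?_
  rw [Zc_congr (Fintype.equivFin X) e ((Fintype.equivFin X).permCongr e) (by simp), Perm.sign_permCongr]
end

section
open Equiv Finset

variable {N : ℕ} {X : Type} [Fintype X] [DecidableEq X]
set_option linter.unusedSectionVars false

/-- signed indicator -/
noncomputable def sg (W : Finset X) (τ : Perm X) : ℤ :=
  open Classical in
  if h : ∀ v, τ v ∈ W ↔ v ∈ W then (Perm.sign (τ.subtypePerm (p := (· ∈ W)) h) : ℤ) else 0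

theorem sg_of_stab (W : Finset X) (τ : Perm X) (h : ∀ v, τ v ∈ W ↔ v ∈ W) :
    sg W τ = (Perm.sign (τ.subtypePerm (p := (· ∈ W)) h) : ℤ) := by
  unfold sg; rw [dif_pos h]

theorem sg_of_not (W : Finset X) (τ : Perm X) (h : ¬ ∀ v, τ v ∈ W ↔ v ∈ W) :
    sg W τ = 0 := by
  unfold sg; rw [dif_neg h]

theorem sg_mul (W : Finset X) (τ ρ : Perm X) (h : ∀ v, τ v ∈ W ↔ v ∈ W) :
    sg W (τ * ρ) = sg W τ * sg W ρ := by
  by_cases hρ : ∀ v, ρ v ∈ W ↔ v ∈ W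
  · have h3 : ∀ v, (τ * ρ) v ∈ W ↔ v ∈ W := fun v => by simp [h, hρ]
    rw [sg_of_stab _ _ h, sg_of_stab _ _ hρ, sg_of_stab _ _ h3, ← Units.val_mul, ← Perm.sign_mul,
      Perm.subtypePerm_mul]
  · rw [sg_of_not W ρ hρ, sg_of_not, mul_zero]
    simpa [h] using hρ

theorem sg_mul' (W : Finset X) (τ ρ : Perm X) (h : ∀ v, ρ v ∈ W ↔ v ∈ W) :
    sg W (τ * ρ) = sg W τ * sg W ρ := by
  by_cases hτ : ∀ v, τ v ∈ W ↔ v ∈ W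
  · exact sg_mul W τ ρ hτ
  · rw [sg_of_not W τ hτ, sg_of_not, zero_mul]
    intro h2
    apply hτ
    intro v
    have a := h2 (ρ⁻¹ v)
    have b := h (ρ⁻¹ v)
    simp at a b
    rw [a, ← b]

theorem sg_swap_in (W : Finset X) {x y : X} (hx : x ∈ W) (hy : y ∈ W) (hxy : x ≠ y) :
    (∀ v, swap x y v ∈ W ↔ v ∈ W) ∧ sg W (swap x y) = -1 := by
  have h : ∀ v, swap x y v ∈ W ↔ v ∈ W := by
    intro v
    rw [swap_apply_def]; split_ifs with h1 h2 <;> simp_all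
  refine ⟨h, ?_⟩
  rw [sg_of_stab _ _ h]
  have : (swap x y).subtypePerm (p := (· ∈ W)) h = swap ⟨x, hx⟩ ⟨y, hy⟩ := by
    ext v
    simp only [Perm.subtypePerm_apply, swap_apply_def, Subtype.ext_iff]
    split_ifs <;> rfl
  rw [this, Perm.sign_swap (by simpa [Subtype.ext_iff] using hxy)]
  simp

theorem sg_swap_out (W : Finset X) {x y : X} (hx : x ∉ W) (hy : y ∉ W) :
    (∀ v, swap x y v ∈ W ↔ v ∈ W) ∧ sg W (swap x y) = 1 := by
  have h : ∀ v, swap x y v ∈ W ↔ v ∈ W := by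
    intro v
    rw [swap_apply_def]; split_ifs with h1 h2 <;> simp_all
  refine ⟨h, ?_⟩
  rw [sg_of_stab _ _ h]
  have : (swap x y).subtypePerm (p := (· ∈ W)) h = 1 := by
    ext v
    have := v.2
    simp only [Perm.subtypePerm_apply, swap_apply_def]
    split_ifs with h1 h2
    · rw [h1] at this; exact absurd this hx
    · rw [h2] at this; exact absurd this hy
    · rfl
  rw [this]
  simp

/-- two exits: vanishing -/
theorem Q_zero (W : Finset X) (σ : Perm X) {x y : X} (hx : x ∈ W) (hy : y ∈ W) (hxy : x ≠ y)
    (hx' : σ x ∉ W) (hy' : σ y ∉ W) : ∑ τ : Perm X, sg W τ * Zc N (τ * σ) = 0 := by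
  have key : ∑ τ : Perm X, sg W τ * Zc N (τ * σ) = - ∑ τ : Perm X, sg W τ * Zc N (τ * σ) := by
    conv_lhs => rw [← Equiv.sum_comp (Equiv.mulLeft (swap x y))]
    conv_lhs => rw [← Equiv.sum_comp (Equiv.mulRight (swap (σ x) (σ y)))]
    rw [← Finset.sum_neg_distrib]
    refine Finset.sum_congr rfl fun τ _ => ?_
    simp only [Equiv.coe_mulLeft, Equiv.coe_mulRight]
    rw [sg_mul _ _ _ (sg_swap_in W hx hy hxy).1, (sg_swap_in W hx hy hxy).2,
      sg_mul' _ _ _ (sg_swap_out W hx' hy').1, (sg_swap_out W hx' hy').2]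
    have : Zc N (swap x y * (τ * swap (σ x) (σ y)) * σ) = Zc N (τ * σ) := by
      have e : swap (σ x) (σ y) * σ = σ * swap x y := by
        ext v; simp [swap_apply_def, apply_ite σ]
      rw [mul_assoc, mul_assoc, e, Zc_comm, mul_assoc, mul_assoc, swap_mul_self, mul_one]
    rw [this]; ring
  linarith

theorem Zc_subtypeCongr (W : Finset X) (a : Perm {v // v ∈ W}) (b : Perm {v // v ∉ W}) :
    Zc N (Perm.subtypeCongr a b) = Zc N a * Zc N b := by
  unfold Zc
  norm_cast
  rw [← Nat.card_prod]
  refine Nat.card_congr ?_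
  refine
    { toFun := fun f => (⟨fun v => f.1 v, ?_⟩, ⟨fun v => f.1 v, ?_⟩)
      invFun := fun f => ⟨fun v => if h : v ∈ W then f.1.1 ⟨v, h⟩ else f.2.1 ⟨v, h⟩, ?_⟩
      left_inv := ?_
      right_inv := ?_ }
  · intro v
    have := f.2 v
    rwa [Perm.subtypeCongr.left_apply_subtype] at this
  · intro v
    have := f.2 v
    rwa [Perm.subtypeCongr.right_apply_subtype] at this
  · intro v
    by_cases hv : v ∈ W
    · rw [Perm.subtypeCongr.left_apply a b hv]
      simp [hv, f.1.2]
    · rw [Perm.subtypeCongr.right_apply a b hv]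
      have := (b ⟨v, hv⟩).2
      simp [hv, this, f.2.2]
  · rintro ⟨f, hf⟩
    simp
  · rintro ⟨⟨f, hf⟩, ⟨g, hg⟩⟩
    simp only [Prod.mk.injEq, Subtype.mk.injEq]
    constructor
    · ext v; simp
    · ext v; simp [v.2]

theorem sum_sg (W : Finset X) (g : Perm X → ℤ) :
    ∑ τ : Perm X, sg W τ * g τ =
      ∑ a : Perm {v // v ∈ W}, ∑ b : Perm {v // v ∉ W},
        (Perm.sign a : ℤ) * g (Perm.subtypeCongr a b) := by
  classical
  rw [← Fintype.sum_prod_type']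
  symm
  refine Finset.sum_of_injOn (fun q => Perm.subtypeCongr q.1 q.2) ?_ (by simp) ?_ ?_
  · have := Perm.subtypeCongrHom_injective (fun v : X => v ∈ W)
    exact fun a _ b _ h => this h
  · intro τ _ h
    by_cases hτ : ∀ v, τ v ∈ W ↔ v ∈ W
    · exfalso; apply h
      refine ⟨(τ.subtypePerm (p := (· ∈ W)) hτ, τ.subtypePerm (p := (· ∉ W)) (fun v => not_congr (hτ v))), by simp, ?_⟩
      ext v
      simp only [Perm.subtypeCongr.apply]
      split_ifs <;> rfl
    · rw [sg_of_not W τ hτ, zero_mul]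
  · rintro ⟨a, b⟩ _
    have hs : ∀ v, Perm.subtypeCongr a b v ∈ W ↔ v ∈ W := by
      intro v
      by_cases hv : v ∈ W
      · rw [Perm.subtypeCongr.left_apply a b hv]; simp [hv]
      · rw [Perm.subtypeCongr.right_apply a b hv]
        have := (b ⟨v, hv⟩).2
        simp [hv, this]
    rw [sg_of_stab _ _ hs]
    have : (Perm.subtypeCongr a b).subtypePerm (p := (· ∈ W)) hs = a := by
      ext v; simp
    rw [this]

theorem sum_sg_Zc [NeZero N] (W : Finset X) :
    ∑ τ : Perm X, sg W τ * Zc N τ =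
      (∏ i ∈ range W.card, ((N:ℤ) - i)) * ∏ i ∈ range (Fintype.card X - W.card), ((N:ℤ) + i) := by
  rw [sum_sg]
  simp_rw [Zc_subtypeCongr, ← mul_assoc]
  rw [← Finset.sum_mul_sum, sum_Zc, sum_sign_Zc]
  simp [Fintype.card_subtype_compl]

theorem Q_one [NeZero N] (W : Finset X) (σ σ' : Perm X) {x y : X} (hx : x ∈ W) (hy : y ∉ W)
    (hσ : σ = swap x y * σ') (h : ∀ v, σ' v ∈ W ↔ v ∈ W) :
    N * ∑ τ : Perm X, sg W τ * Zc N (τ * σ) =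
     sg W σ' * ((∏ i ∈ range W.card, ((N:ℤ) - i)) *
       ∏ i ∈ range (Fintype.card X - W.card), ((N:ℤ) + i)) := by
  rw [← sum_sg_Zc, Finset.mul_sum, Finset.mul_sum]
  conv_rhs => rw [← Equiv.sum_comp (Equiv.mulLeft σ')]
  refine Finset.sum_congr rfl fun τ _ => ?_
  simp only [Equiv.coe_mulLeft]
  by_cases hτ : ∀ v, τ v ∈ W ↔ v ∈ W
  · rw [sg_mul _ _ _ h, Zc_comm, hσ, mul_assoc, ← Zc_swap W (σ' * τ) (by simp [h, hτ]) hx hy]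
    have : sg W σ' * sg W σ' = 1 := by
      rw [sg_of_stab _ _ h, ← Units.val_mul, Int.units_mul_self]; rfl
    linear_combination (-(N:ℤ) * sg W τ * Zc N (swap x y * (σ' * τ))) * this
  · rw [sg_mul _ _ _ h, sg_of_not _ _ hτ]; simp
end

section
open Equiv Finset

variable {N : ℕ} {X : Type} [Fintype X] [DecidableEq X]
set_option linter.unusedSectionVars false

theorem sg_ofSubtype (W : Finset X) (τ : Perm X) (h : ∀ v, τ v ∈ W ↔ v ∈ W) (ρ : Perm X)
    (hin : ∀ v ∈ W, ρ v = τ v) (hout : ∀ v, v ∉ W → ρ v = v) : sg W τ = (Perm.sign ρ : ℤ) := by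
  rw [sg_of_stab _ _ h, ← Perm.sign_ofSubtype]
  congr 2
  ext v
  by_cases hv : v ∈ W
  · rw [hin v hv, Perm.ofSubtype_apply_of_mem (p := (· ∈ W)) _ hv]; rfl
  · rw [hout v hv, Perm.ofSubtype_apply_of_not_mem (p := (· ∈ W)) _ hv]

theorem sg_union (W C : Finset X) (τ : Perm X) (h : ∀ v, τ v ∈ W ↔ v ∈ W)
    (hC : ∀ v, τ v ∈ C ↔ v ∈ C) (hd : Disjoint W C) : sg (W ∪ C) τ = sg W τ * sg C τ := by
  set a : Perm X := Perm.ofSubtype (τ.subtypePerm (p := (· ∈ W)) h) with ha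
  set b : Perm X := Perm.ofSubtype (τ.subtypePerm (p := (· ∈ C)) hC) with hb
  have a1 : ∀ v ∈ W, a v = τ v := fun v hv => by
    rw [ha, Perm.ofSubtype_apply_of_mem (p := (· ∈ W)) _ hv]; rfl
  have a2 : ∀ v, v ∉ W → a v = v := fun v hv => by
    rw [ha, Perm.ofSubtype_apply_of_not_mem (p := (· ∈ W)) _ hv]
  have b1 : ∀ v ∈ C, b v = τ v := fun v hv => by
    rw [hb, Perm.ofSubtype_apply_of_mem (p := (· ∈ C)) _ hv]; rfl
  have b2 : ∀ v, v ∉ C → b v = v := fun v hv => by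
    rw [hb, Perm.ofSubtype_apply_of_not_mem (p := (· ∈ C)) _ hv]
  rw [sg_ofSubtype W τ h a a1 a2, sg_ofSubtype C τ hC b b1 b2, ← Units.val_mul, ← Perm.sign_mul]
  rw [Finset.disjoint_left] at hd
  apply sg_ofSubtype
  · intro v; simp [h, hC]
  · intro v hv
    rw [Finset.mem_union] at hv
    rcases hv with hv | hv
    · rw [Perm.mul_apply, b2 v (hd hv), a1 v hv]
    · rw [Perm.mul_apply, b1 v hv, a2]
      intro h3; exact hd h3 ((hC v).2 hv)
  · intro v hv
    rw [Finset.mem_union, not_or] at hv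
    rw [Perm.mul_apply, b2 v hv.2, a2 v hv.1]

theorem sg_cycle (τ : Perm X) (u : X) (C : Finset X) (hC : ∀ v, v ∈ C ↔ τ.SameCycle u v) :
    (-1) ^ C.card * sg C τ = -1 := by
  have hs : ∀ v, τ v ∈ C ↔ v ∈ C := by intro v; rw [hC, hC]; simp
  rw [sg_ofSubtype C τ hs (τ.cycleOf u)
    (fun v hv => ((hC v).1 hv).cycleOf_apply)
    (fun v hv => Perm.cycleOf_apply_of_not_sameCycle (by rwa [← hC]))]
  by_cases hu : τ u = u
  · have : C = {u} := by
      ext v; rw [hC, Finset.mem_singleton]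
      constructor
      · rintro ⟨k, hk⟩
        rw [← hk]; exact Perm.zpow_apply_eq_self_of_apply_eq_self hu k
      · rintro rfl; exact Perm.SameCycle.refl _ _
    rw [this, (Perm.cycleOf_eq_one_iff τ).2 hu]; simp
  · rw [(Perm.isCycle_cycleOf τ hu).sign]
    have : (τ.cycleOf u).support = C := by
      ext v
      rw [Perm.mem_support_cycleOf_iff, hC]
      simp [hu]
    rw [this]
    simp [← mul_pow]

theorem cyc_indicator (o : X) (τ : Perm X) [Decidable (∀ v, τ.SameCycle o v)] :
    ∑ W ∈ univ.filter (fun W : Finset X => o ∉ W), (-1) ^ W.card * sg W τ =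
      if ∀ v, τ.SameCycle o v then 1 else 0 := by
  classical
  split_ifs with ht
  · rw [Finset.sum_eq_single ∅]
    · rw [sg_of_stab _ _ (by simp)]
      have : (τ.subtypePerm (p := (· ∈ (∅ : Finset X))) (by simp)) = 1 := by
        ext v; exact absurd v.2 (Finset.notMem_empty _)
      rw [this]; simp
    · intro W hW hne
      rw [sg_of_not, mul_zero]
      intro h
      obtain ⟨w, hw⟩ := Finset.nonempty_iff_ne_empty.2 hne
      have h2 : ∀ k : ℕ, (τ ^ k) o ∉ W := by
        intro k
        induction k with
        | zero => simpa using hW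
        | succ k ih => rw [pow_succ', Perm.mul_apply, h]; exact ih
      obtain ⟨k, hk⟩ := (ht w).exists_nat_pow_eq
      exact h2 k (hk ▸ hw)
    · simp
  · push Not at ht
    obtain ⟨u, hu⟩ := ht
    set C : Finset X := univ.filter (fun v => τ.SameCycle u v) with hCdef
    have hC : ∀ v, v ∈ C ↔ τ.SameCycle u v := by simp [hCdef]
    have hs : ∀ v, τ v ∈ C ↔ v ∈ C := by intro v; rw [hC, hC]; simp
    have hoC : o ∉ C := by rw [hC]; exact fun h => hu h.symm
    have huC : u ∈ C := by rw [hC]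
    have hsym : ∀ W : Finset X, (∀ v, τ v ∈ W ↔ v ∈ W) → (∀ v, τ v ∈ symmDiff W C ↔ v ∈ symmDiff W C) := by
      intro W h v; simp [Finset.mem_symmDiff, h, hs]
    have key : ∀ W : Finset X, (∀ v, τ v ∈ W ↔ v ∈ W) → Disjoint W C →
        (-1) ^ W.card * sg W τ + (-1) ^ (W ∪ C).card * sg (W ∪ C) τ = 0 := by
      intro W h hd
      rw [sg_union W C τ h hs hd, Finset.card_union_of_disjoint hd, pow_add]
      linear_combination ((-1) ^ W.card * sg W τ) * sg_cycle τ u C hC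
    refine Finset.sum_involution (fun W _ => symmDiff W C) ?_ ?_ ?_ ?_
    · intro W hW
      by_cases h : ∀ v, τ v ∈ W ↔ v ∈ W
      · by_cases huW : u ∈ W
        · have hsub : C ⊆ W := by
            intro v hv
            obtain ⟨k, hk⟩ := ((hC v).1 hv).exists_nat_pow_eq
            rw [← hk]
            clear hk
            induction k with
            | zero => simpa using huW
            | succ k ih => rw [pow_succ', Perm.mul_apply, h]; exact ih
          have e1 : symmDiff W C = W \ C := by
            rw [symmDiff_def, Finset.sdiff_eq_empty_iff_subset.2 hsub]; simp
          have e2 : (W \ C) ∪ C = W := Finset.sdiff_union_of_subset hsub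
          have := key (W \ C) (by rw [← e1]; exact hsym W h) Finset.sdiff_disjoint
          rw [e2] at this
          rw [e1, add_comm]; exact this
        · have hd : Disjoint W C := by
            rw [Finset.disjoint_left]
            intro v hv hvC
            apply huW
            obtain ⟨k, hk⟩ := ((hC v).1 hvC).symm.exists_nat_pow_eq
            rw [← hk]
            clear hk
            induction k with
            | zero => simpa using hv
            | succ k ih => rw [pow_succ', Perm.mul_apply, h]; exact ih
          have e1 : symmDiff W C = W ∪ C := by
            rw [hd.symmDiff_eq_sup]; rfl
          simp only [e1]; exact key W h hd
      · rw [sg_of_not _ _ h, sg_of_not]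
        · simp
        · intro h2
          apply h
          have := hsym _ h2
          rwa [symmDiff_symmDiff_cancel_right] at this
    · intro W hW _ h
      have : C = ∅ := by simpa using h
      rw [this] at huC; simp at huC
    · intro W hW
      simp only [Finset.mem_filter, Finset.mem_univ, true_and] at hW ⊢
      simp [Finset.mem_symmDiff, hW, hoC]
    · intro W hW
      exact symmDiff_symmDiff_cancel_right _ _
end

section
open Equiv Finset

variable {N : ℕ}

def Iv (n a b : ℕ) : Finset (Fin (n+1)) := univ.filter (fun v => a ≤ v.val ∧ v.val ≤ b)

theorem mem_Iv {n a b : ℕ} (v : Fin (n+1)) : v ∈ Iv n a b ↔ a ≤ v.val ∧ v.val ≤ b := by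
  simp [Iv]

theorem card_Iv {n a b : ℕ} (hb : b ≤ n) : (Iv n a b).card = b + 1 - a := by
  rw [← Nat.card_Icc, ← Finset.card_map Fin.valEmbedding]
  congr 1
  ext x
  simp only [Finset.mem_map, mem_Iv, Fin.valEmbedding_apply, Finset.mem_Icc]
  constructor
  · rintro ⟨v, hv, rfl⟩; exact hv
  · intro h; exact ⟨⟨x, by omega⟩, h, rfl⟩

theorem rot_val {n : ℕ} (v : Fin (n+1)) :
    (finRotate (n+1) v).val = if v.val = n then 0 else v.val + 1 := by
  have := coe_finRotate v
  rw [this]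
  simp [Fin.ext_iff]

theorem Q_Iv [NeZero N] {n a k : ℕ} (ha : 1 ≤ a) (hb : a + k ≤ n) :
    (N:ℤ) * ((-1) ^ (Iv n a (a+k)).card * ∑ τ : Perm (Fin (n+1)), sg (Iv n a (a+k)) τ * Zc N (τ * finRotate (n+1))) =
     - ((∏ i ∈ range (k+1), ((N:ℤ) - i)) * ∏ i ∈ range (n - k), ((N:ℤ) + i)) := by
  set W := Iv n a (a+k) with hW
  set x : Fin (n+1) := ⟨a, by omega⟩ with hx
  set j : Fin (n+1) := ⟨a+k, by omega⟩ with hj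
  set y : Fin (n+1) := finRotate (n+1) j with hy
  have yv : y.val = if a + k = n then 0 else a + k + 1 := by rw [hy, rot_val]
  have xW : x ∈ W := by rw [mem_Iv]; simp [hx]
  have yW : y ∉ W := by
    rw [mem_Iv, yv]; split_ifs <;> omega
  set σ' : Perm (Fin (n+1)) := swap x y * finRotate (n+1) with hσ'
  have σv : ∀ v, (σ' v).val = if v.val + 1 = a then y.val else if v.val = a + k then a else if v.val = n then 0 else v.val + 1 := by
    intro v
    rw [hσ', Perm.mul_apply, swap_apply_def]
    have r := rot_val v
    simp only [Fin.ext_iff]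
    have hxv : x.val = a := rfl
    rw [r, yv, hxv]
    split_ifs <;> first | omega | simp_all
  have stab : ∀ v, σ' v ∈ W ↔ v ∈ W := by
    intro v
    rw [mem_Iv, mem_Iv, σv, yv]
    have := v.2
    split_ifs <;> omega
  have hcyc : ∀ v, v ∈ W ↔ σ'.SameCycle x v := by
    intro v
    constructor
    · have : ∀ l, l ≤ k → ((σ' ^ l) x).val = a + l := by
        intro l
        induction l with
        | zero => intro _; rfl
        | succ l ih =>
          intro hl
          rw [pow_succ', Perm.mul_apply, σv, ih (by omega)]
          split_ifs <;> omega
      intro hv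
      rw [mem_Iv] at hv
      refine ⟨((v.val - a : ℕ) : ℤ), ?_⟩
      rw [zpow_natCast]
      apply Fin.ext
      rw [this _ (by omega)]; omega
    · intro h
      obtain ⟨l, hl⟩ := h.exists_nat_pow_eq
      rw [← hl]; clear hl
      induction l with
      | zero => simpa using xW
      | succ l ih => rw [pow_succ', Perm.mul_apply, stab]; exact ih
  have h1 := sg_cycle σ' x W hcyc
  have h2 := Q_one (N := N) W (finRotate (n+1)) σ' xW yW (by rw [hσ', ← mul_assoc]; simp) stab
  have hc : W.card = k + 1 := by rw [hW, card_Iv hb]; omega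
  rw [mul_left_comm, h2]
  have e : Fintype.card (Fin (n+1)) - W.card = n - k := by rw [hc]; simp
  rw [e, ← mul_assoc, h1, hc]; ring

theorem two_exits {n : ℕ} (W : Finset (Fin (n+1))) (h0 : 0 ∉ W) (hne : W.Nonempty)
    (h : ∀ a b, 1 ≤ a → a ≤ b → b ≤ n → W ≠ Iv n a b) :
    ∃ x y, x ∈ W ∧ y ∈ W ∧ x ≠ y ∧ finRotate (n+1) x ∉ W ∧ finRotate (n+1) y ∉ W := by
  set i := W.min' hne
  set j := W.max' hne
  have hi : i ∈ W := W.min'_mem hne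
  have hj : j ∈ W := W.max'_mem hne
  have hij : i ≤ j := W.min'_le _ hj
  have i0 : i ≠ 0 := fun h => h0 (h ▸ hi)
  have i1 : 1 ≤ i.val := by
    rw [Nat.one_le_iff_ne_zero]; intro h; exact i0 (Fin.ext h)
  have jn : j.val ≤ n := by have := j.2; omega
  have hW := h i.val j.val i1 hij jn
  have : ∃ v, v ∈ Iv n i j ∧ v ∉ W := by
    by_contra hcon
    push Not at hcon
    apply hW
    apply Finset.Subset.antisymm
    · intro v hv
      rw [mem_Iv]
      exact ⟨W.min'_le _ hv, W.le_max' _ hv⟩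
    · exact hcon
  obtain ⟨v, hv, hvW⟩ := this
  rw [mem_Iv] at hv
  have hne2 : (W.filter (· < v)).Nonempty := by
    refine ⟨i, ?_⟩
    rw [Finset.mem_filter]
    refine ⟨hi, lt_of_le_of_ne hv.1 ?_⟩
    intro h; exact hvW (h ▸ hi)
  set w := (W.filter (· < v)).max' hne2
  have hw : w ∈ W.filter (· < v) := Finset.max'_mem _ hne2
  rw [Finset.mem_filter] at hw
  have hwv : w.val < v.val := hw.2
  refine ⟨w, j, hw.1, hj, ?_, ?_, ?_⟩
  · intro h
    have : w.val = j.val := by rw [h]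
    omega
  · intro hr
    have r := rot_val w
    rw [if_neg (by have := v.2; omega)] at r
    have hnv : (finRotate (n+1) w).val ≠ v.val := fun h => hvW (Fin.ext h ▸ hr)
    have hm : finRotate (n+1) w ∈ W.filter (· < v) := by
      rw [Finset.mem_filter]
      refine ⟨hr, ?_⟩
      rw [Fin.lt_def]; omega
    have := Finset.le_max' _ _ hm
    have h3 : (finRotate (n+1) w).val ≤ w.val := this
    omega
  · intro hr
    have r := rot_val j
    have h3 : (finRotate (n+1) j).val ≤ j.val := W.le_max' _ hr
    split_ifs at r with h4
    · exact h0 (by rwa [show (0 : Fin (n+1)) = finRotate (n+1) j from Fin.ext (by rw [r]; rfl)])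
    · omega

theorem main_sum [NeZero N] (n : ℕ) [DecidablePred fun τ : Perm (Fin (n+1)) => ∀ v, τ.SameCycle 0 v] :
    (N:ℤ) * ∑ τ ∈ univ.filter (fun τ : Perm (Fin (n+1)) => ∀ v, τ.SameCycle 0 v), Zc N (τ * finRotate (n+1)) =
    N * ∏ i ∈ range (n+1), ((N:ℤ) + i) - ∑ k ∈ range n, ((n:ℤ) - k) *
     ((∏ i ∈ range (k+1), ((N:ℤ) - i)) * ∏ i ∈ range (n - k), ((N:ℤ) + i)) := by
  classical
  set g : Finset (Fin (n+1)) → ℤ := fun W => (N:ℤ) * ((-1) ^ W.card * ∑ τ : Perm (Fin (n+1)), sg W τ * Zc N (τ * finRotate (n+1))) with hg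
  have e1 : (N:ℤ) * ∑ τ ∈ univ.filter (fun τ : Perm (Fin (n+1)) => ∀ v, τ.SameCycle 0 v), Zc N (τ * finRotate (n+1)) = ∑ W ∈ univ.filter (fun W : Finset (Fin (n+1)) => 0 ∉ W), g W := by
    rw [Finset.sum_filter]
    rw [hg, ← Finset.mul_sum]
    congr 1
    simp_rw [Finset.mul_sum]
    rw [Finset.sum_comm]
    refine Finset.sum_congr rfl fun τ _ => ?_
    simp_rw [← mul_assoc]
    rw [← Finset.sum_mul, cyc_indicator]
    split_ifs <;> simp
  have e2 : g ∅ = N * ∏ i ∈ range (n+1), ((N:ℤ) + i) := by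
    simp only [hg]
    have : ∀ τ : Perm (Fin (n+1)), sg ∅ τ = 1 := by
      intro τ
      rw [sg_of_stab _ _ (by simp)]
      have : (τ.subtypePerm (p := (· ∈ (∅ : Finset (Fin (n+1))))) (by simp)) = 1 := by
        ext v; exact absurd v.2 (Finset.notMem_empty _)
      rw [this]; simp
    simp only [this]
    have h3 := Equiv.sum_comp (Equiv.mulRight (finRotate (n+1))) (fun τ => Zc N τ)
    simp only [Equiv.coe_mulRight] at h3
    simp [h3, sum_Zc]
  rw [e1, ← Finset.add_sum_erase _ _ (a := ∅) (by simp), e2, sub_eq_add_neg]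
  congr 1
  rw [← Finset.sum_neg_distrib]
  have e3 : ∑ k ∈ range n, -(((n:ℤ) - k) *
     ((∏ i ∈ range (k+1), ((N:ℤ) - i)) * ∏ i ∈ range (n - k), ((N:ℤ) + i))) =
     ∑ q ∈ (range n).sigma (fun k => range (n - k)), g (Iv n (q.2 + 1) (q.2 + 1 + q.1)) := by
    rw [Finset.sum_sigma]
    refine Finset.sum_congr rfl fun k hk => ?_
    rw [Finset.mem_range] at hk
    rw [Finset.sum_congr rfl (g := fun _ => -((∏ i ∈ range (k+1), ((N:ℤ) - i)) * ∏ i ∈ range (n - k), ((N:ℤ) + i)))]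
    · rw [Finset.sum_const, Finset.card_range, nsmul_eq_mul, Nat.cast_sub hk.le]; ring
    · intro i hi
      rw [Finset.mem_range] at hi
      exact Q_Iv (a := i + 1) (k := k) (by omega) (by omega)
  rw [e3]
  symm
  refine Finset.sum_of_injOn (fun q => Iv n (q.2 + 1) (q.2 + 1 + q.1)) ?_ ?_ ?_ ?_
  · rintro ⟨k, a⟩ h1 ⟨k', a'⟩ h2 h
    simp only [Finset.coe_sigma, Set.mem_sigma_iff, Finset.coe_range, Set.mem_Iio] at h1 h2
    simp only at h
    have m := fun v => Finset.ext_iff.1 h v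
    simp only [mem_Iv] at m
    have m1 := m ⟨a+1, by omega⟩
    have m2 := m ⟨a+1+k, by omega⟩
    have m3 := m ⟨a'+1, by omega⟩
    have m4 := m ⟨a'+1+k', by omega⟩
    simp only at m1 m2 m3 m4
    have : a = a' := by omega
    have : k = k' := by omega
    subst_vars; rfl
  · rintro ⟨k, a⟩ h1
    simp only [Finset.coe_sigma, Set.mem_sigma_iff, Finset.coe_range, Set.mem_Iio] at h1
    simp only [Finset.coe_erase, Set.mem_sdiff, Finset.mem_coe, Finset.mem_filter, Finset.mem_univ, true_and, Set.mem_singleton_iff]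
    constructor
    · rw [mem_Iv]; simp
    · rw [← Finset.card_eq_zero, card_Iv (by omega)]; omega
  · intro W hW hni
    simp only [Finset.mem_erase, Finset.mem_filter, Finset.mem_univ, true_and] at hW
    obtain ⟨x, y, hx, hy, hxy, hx', hy'⟩ := two_exits W hW.2 (Finset.nonempty_iff_ne_empty.2 hW.1) (by
      intro a b ha hab hb h
      apply hni
      refine ⟨⟨b - a, a - 1⟩, ?_, ?_⟩
      · simp only [Finset.coe_sigma, Set.mem_sigma_iff, Finset.coe_range, Set.mem_Iio]; omega
      · simp only
        rw [h]; congr 1 <;> omega)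
    simp only [hg]
    rw [Q_zero W _ hx hy hxy hx' hy']; simp
  · intro q _; rfl

theorem closed_form (R F : ℕ → ℤ) (N : ℤ) (hR0 : R 0 = 1) (hF0 : F 0 = 1)
    (hR : ∀ k, R (k+1) = R k * (N + k)) (hF : ∀ k, F (k+1) = F k * (N - k)) (n : ℕ) :
    ((n:ℤ)+1)*(n+2) * (N * R (n+1) - ∑ k ∈ range n, ((n:ℤ) - k) * (F (k+1) * R (n - k))) =
      N * (R (n+2) - F (n+2)) := by
  have key : ∀ j, j ≤ n → ((n:ℤ)+1)*(n+2) * ∑ k ∈ range j, ((n:ℤ) - k) * (F (k+1) * R (n - k)) =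
      ((n+1)*(j+1) + N - (n+1)*(n+2)) * (F (j+1) * R (n+1-j)) - ((n+1) + N - (n+1)*(n+2)) * (F 1 * R (n+1)) := by
    intro j
    induction j with
    | zero => intro _; simp
    | succ j ih =>
      intro hj
      rw [Finset.sum_range_succ, mul_add, ih (by omega)]
      obtain ⟨d, rfl⟩ : ∃ d, n = j + 1 + d := ⟨n - (j+1), by omega⟩
      have a1 : j + 1 + d - j = d + 1 := by omega
      have a2 : j + 1 + d + 1 - j = d + 1 + 1 := by omega
      have a3 : j + 1 + d + 1 - (j + 1) = d + 1 := by omega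
      rw [a1, a2, a3, hR (d+1), hF (j+1)]
      push_cast
      ring
  have := key n le_rfl
  rw [mul_sub, this]
  have a1 : n + 1 - n = 0 + 1 := by omega
  rw [a1, hR 0, hR (n+1), hF (n+1), hF 0, hR0, hF0]
  push_cast
  ring
end

section
open Equiv Finset

variable {N : ℕ}

theorem Zc_orbits [NeZero N] {X : Type} [Finite X] (α : Perm X) :
    Zc N α = (N:ℤ) ^ Nat.card (MulAction.orbitRel.Quotient (Subgroup.zpowers α) X) := by
  unfold Zc
  have h : Nat.card (MulAction.orbitRel.Quotient (Subgroup.zpowers α) X → ZMod N) =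
      N ^ Nat.card (MulAction.orbitRel.Quotient (Subgroup.zpowers α) X) := by
    rw [Nat.card_fun, Nat.card_zmod]
  norm_cast
  rw [← h]
  refine Nat.card_congr ?_
  refine
    { toFun := fun f => Quotient.lift f.1 ?_
      invFun := fun g => ⟨fun v => g (Quotient.mk _ v), ?_⟩
      left_inv := ?_
      right_inv := ?_ }
  · intro a b hab
    have hab' : a ∈ MulAction.orbit (Subgroup.zpowers α) b := hab
    obtain ⟨⟨g, hg⟩, rfl⟩ := hab'
    obtain ⟨k, rfl⟩ := Subgroup.mem_zpowers_iff.1 hg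
    change f.1 ((α ^ k) b) = f.1 b
    induction k using Int.induction_on with
    | zero => simp
    | succ i ih =>
      rw [add_comm, zpow_add, zpow_one, Perm.mul_apply, f.2]
      exact ih (Subgroup.zpow_mem_zpowers _ _) ⟨⟨_, Subgroup.zpow_mem_zpowers _ _⟩, rfl⟩
    | pred i ih =>
      have e : (α ^ (-(i:ℤ))) b = α ((α ^ (-(i:ℤ) - 1)) b) := by
        rw [← Perm.mul_apply, ← zpow_one_add]; congr 2; ring
      rw [← f.2, ← e]
      exact ih (Subgroup.zpow_mem_zpowers _ _) ⟨⟨_, Subgroup.zpow_mem_zpowers _ _⟩, rfl⟩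
  · intro v
    refine congrArg g ?_
    apply Quotient.sound
    exact ⟨⟨α, Subgroup.mem_zpowers α⟩, rfl⟩
  · rintro ⟨f, hf⟩; rfl
  · intro g
    funext q
    induction q using Quotient.inductionOn with
    | h v => rfl

/-- `pihat`, on `Fin`. -/
def ph {n : ℕ} (π : Perm (Fin n)) : Perm (Fin (n+1)) := Perm.decomposeFin.symm (0, π)

theorem cpi_eq {n : ℕ} (π : Perm (Fin n)) :
    (cpi π : Perm (Fin (n+1))) = ph π * (finRotate (n+1))⁻¹ * (ph π)⁻¹ * finRotate (n+1) := by
  have h : (finRotate (n+1))⁻¹ = (Equiv.subRight (1 : Fin (n+1))) := by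
    rw [inv_eq_iff_mul_eq_one]
    ext v
    simp
  have key : ∀ v : Fin (n+1), (ph π * (finRotate (n+1))⁻¹ * (ph π)⁻¹ * finRotate (n+1)) v =
      ph π ((ph π).symm (v + 1) - 1) := by
    intro v
    rw [h]
    simp only [Perm.mul_apply, finRotate_apply]
    rfl
  exact Equiv.ext fun v => (key v).symm

theorem A_spec {n : ℕ} (π : Perm (Fin n)) :
    (∀ N : ℕ, N ≠ 0 → Zc N (ph π * (finRotate (n+1))⁻¹ * (ph π)⁻¹ * finRotate (n+1)) = (N:ℤ) ^ A n π) ∧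
    ∃ g ∈ range (n/2+1), A n π = n + 1 - 2 * g := by
  have h1 : ∀ N : ℕ, N ≠ 0 → Zc N (ph π * (finRotate (n+1))⁻¹ * (ph π)⁻¹ * finRotate (n+1)) = (N:ℤ) ^ A n π := by
    intro N hN
    have : NeZero N := ⟨hN⟩
    rw [← cpi_eq]
    exact Zc_orbits (X := Fin (n+1)) (cpi π)
  refine ⟨h1, ?_⟩
  obtain ⟨c, hc, h2, h3⟩ := Zc_pow (ph π * (finRotate (n+1))⁻¹ * (ph π)⁻¹ * finRotate (n+1))
  have hAc : A n π = c := by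
    have := (h1 2 (by norm_num)).symm.trans (h2 2 (by norm_num))
    exact Nat.pow_right_injective (le_refl 2) (by exact_mod_cast this)
  have hpos : 0 < A n π := by
    unfold A
    have : Nonempty (MulAction.orbitRel.Quotient (Subgroup.zpowers (cpi π)) (ZMod (n+1))) :=
      ⟨Quotient.mk _ 0⟩
    have : Finite (ZMod (n+1)) := inferInstanceAs (Finite (Fin (n+1)))
    have : Finite (MulAction.orbitRel.Quotient (Subgroup.zpowers (cpi π)) (ZMod (n+1))) :=
      Quotient.finite _
    exact Nat.card_pos
  have hs : Perm.sign (ph π * (finRotate (n+1))⁻¹ * (ph π)⁻¹ * finRotate (n+1)) = 1 := by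
    simp only [Perm.sign_mul, Perm.sign_inv]
    rw [mul_right_comm, mul_assoc (Perm.sign (ph π)), mul_comm (Perm.sign (ph π)), mul_assoc, mul_assoc, ]
    simp
  rw [hs] at h3
  have hev : Even (n + 1 + c) := by
    by_contra hodd
    rw [Nat.not_even_iff_odd] at hodd
    rw [hodd.neg_one_pow] at h3
    norm_num at h3
  obtain ⟨r, hr⟩ := hev
  refine ⟨n + 1 - r, ?_, ?_⟩
  · rw [Finset.mem_range]; omega
  · omega

theorem p_eq (n : ℕ) (z : ℤ) : p n z = ∑ π : Perm (Fin n), z ^ A n π := by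
  classical
  unfold p
  have : ∀ g, (H n (n+1-2*g) : ℤ) * z ^ (n+1-2*g) =
      ∑ π : Perm (Fin n), if A n π = n+1-2*g then z ^ A n π else 0 := by
    intro g
    unfold H
    rw [Nat.card_eq_fintype_card, Fintype.card_subtype, ← Finset.sum_filter]
    rw [Finset.sum_congr rfl (g := fun _ => z ^ (n+1-2*g))]
    · simp
    · intro π hπ; rw [(Finset.mem_filter.1 hπ).2]
  simp_rw [this]
  rw [Finset.sum_comm]
  refine Finset.sum_congr rfl fun π _ => ?_
  obtain ⟨g, hg, h⟩ := (A_spec π).2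
  rw [Finset.sum_eq_single g]
  · simp [h]
  · intro g' hg' hne
    rw [if_neg]
    rw [Finset.mem_range] at hg hg'
    omega
  · intro h'; exact absurd hg h'

theorem rot_trans {n : ℕ} (v : Fin (n+1)) : (finRotate (n+1)).SameCycle 0 v := by
  have : ∀ l, l ≤ n → ((finRotate (n+1) ^ l) 0).val = l := by
    intro l
    induction l with
    | zero => intro _; rfl
    | succ l ih =>
      intro hl
      rw [pow_succ', Perm.mul_apply, rot_val, ih (by omega), if_neg (by omega)]
  refine ⟨(v.val : ℤ), ?_⟩
  rw [zpow_natCast]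
  exact Fin.ext (this _ (by have := v.2; omega))

theorem ph_zero {n : ℕ} (π : Perm (Fin n)) : ph π 0 = 0 := by simp [ph]

theorem ph_surj {n : ℕ} (g : Perm (Fin (n+1))) (hg : g 0 = 0) : ∃ π : Perm (Fin n), ph π = g := by
  obtain ⟨⟨q, π⟩, rfl⟩ := Perm.decomposeFin.symm.surjective g
  refine ⟨π, ?_⟩
  have : q = 0 := by simpa using hg
  rw [this]; rfl

theorem trans_conj {n : ℕ} (τ : Perm (Fin (n+1))) (h : ∀ v, τ.SameCycle 0 v) :
    ∃ π : Perm (Fin n), ph π * (finRotate (n+1))⁻¹ * (ph π)⁻¹ = τ := by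
  obtain ⟨g, hg⟩ : ∃ g : Perm (Fin (n+1)), g * (finRotate (n+1))⁻¹ * g⁻¹ = τ := by
    rcases Nat.eq_zero_or_pos n with rfl | hn
    · have : Subsingleton (Perm (Fin (0+1))) := inferInstanceAs (Subsingleton (Perm (Fin 1)))
      exact ⟨1, Subsingleton.elim _ _⟩
    · have hne : ∀ v, τ v ≠ v := by
        intro v hv
        have h2 : ∀ w, w = v := by
          intro w
          obtain ⟨k, hk⟩ := (h v).symm.trans (h w)
          rw [← hk]; exact Perm.zpow_apply_eq_self_of_apply_eq_self hv k
        have := (h2 0).trans (h2 (Fin.last n)).symm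
        rw [Fin.ext_iff] at this
        simp at this
        omega
      have c1 : τ.IsCycle := ⟨0, hne 0, fun y _ => h y⟩
      have c2 : ((finRotate (n+1))⁻¹).IsCycle := (isCycle_finRotate_of_le (by omega)).inv
      have s1 : τ.support = univ := by ext v; simp [hne v]
      have s2 : ((finRotate (n+1))⁻¹).support = univ := by
        rw [Perm.support_inv, support_finRotate_of_le (by omega)]
      have := c2.isConj c1 (by rw [s1, s2])
      exact isConj_iff.1 this
  obtain ⟨k, hk⟩ := rot_trans (g⁻¹ 0)
  obtain ⟨π, hπ⟩ := ph_surj (g * finRotate (n+1) ^ k) (by rw [Perm.mul_apply, hk]; simp)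
  refine ⟨π, ?_⟩
  rw [hπ, ← hg]
  group

theorem ph_inj {n : ℕ} (π π' : Perm (Fin n))
    (h : ph π * (finRotate (n+1))⁻¹ * (ph π)⁻¹ = ph π' * (finRotate (n+1))⁻¹ * (ph π')⁻¹) : π = π' := by
  set g := (ph π')⁻¹ * ph π with hg
  have hcomm : Commute g (finRotate (n+1)) := by
    have : g * (finRotate (n+1))⁻¹ = (finRotate (n+1))⁻¹ * g := by
      rw [hg, mul_assoc, mul_inv_eq_iff_eq_mul.1 h]
      group
    have h2 : Commute g (finRotate (n+1))⁻¹ := this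
    simpa using h2.inv_right
  have g0 : g 0 = 0 := by
    rw [hg, Perm.mul_apply, ph_zero, Perm.inv_eq_iff_eq, ph_zero]
  have g1 : g = 1 := by
    ext v
    obtain ⟨k, rfl⟩ := rot_trans v
    rw [← Perm.mul_apply, (hcomm.zpow_right k).eq, Perm.mul_apply, g0]; rfl
  have : ph π = ph π' := by
    rw [hg, inv_mul_eq_one] at g1; exact g1.symm
  have h3 := Perm.decomposeFin.symm.injective this
  exact (Prod.ext_iff.1 h3).2

theorem p_closed [NeZero N] (n : ℕ) :
    ((n:ℤ)+1)*(n+2) * p n N = ∏ i ∈ range (n+2), ((N:ℤ) + i) - ∏ i ∈ range (n+2), ((N:ℤ) - i) := by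
  classical
  have hN : (N:ℤ) ≠ 0 := by exact_mod_cast NeZero.ne N
  have e : p n N = ∑ τ ∈ univ.filter (fun τ : Perm (Fin (n+1)) => ∀ v, τ.SameCycle 0 v), Zc N (τ * finRotate (n+1)) := by
    rw [p_eq]
    refine Finset.sum_bij (fun π _ => ph π * (finRotate (n+1))⁻¹ * (ph π)⁻¹) ?_ ?_ ?_ ?_
    · intro π _
      rw [Finset.mem_filter]
      refine ⟨Finset.mem_univ _, fun v => ?_⟩
      rw [Perm.sameCycle_conj, Perm.sameCycle_inv]
      exact (rot_trans _).symm.trans (rot_trans _)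
    · intro π _ π' _ h; exact ph_inj π π' h
    · intro τ hτ
      obtain ⟨π, hπ⟩ := trans_conj τ (Finset.mem_filter.1 hτ).2
      exact ⟨π, Finset.mem_univ _, hπ⟩
    · intro π _
      exact ((A_spec π).1 N (NeZero.ne N)).symm
  apply mul_left_cancel₀ hN
  have h1 := main_sum (N := N) n
  rw [← e] at h1
  have h2 := closed_form (fun k => ∏ i ∈ range k, ((N:ℤ) + i)) (fun k => ∏ i ∈ range k, ((N:ℤ) - i)) N
    (by simp) (by simp) (fun k => Finset.prod_range_succ _ _) (fun k => Finset.prod_range_succ _ _) n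
  rw [← h1] at h2
  linear_combination h2

theorem rec_pos [NeZero N] (m : ℕ) :
    ((m:ℤ) + 4) * p (m+2) N = (2 * m + 5) * N * p (m+1) N + (m + 1) * ((m+2)^2 - (N:ℤ)^2) * p m N := by
  have a := p_closed (N := N) m
  have b := p_closed (N := N) (m+1)
  have c := p_closed (N := N) (m+2)
  rw [Finset.prod_range_succ _ (m+2), Finset.prod_range_succ _ (m+2)] at b
  rw [Finset.prod_range_succ _ (m+3), Finset.prod_range_succ _ (m+3), Finset.prod_range_succ _ (m+2), Finset.prod_range_succ _ (m+2)] at c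
  set R := ∏ i ∈ range (m+2), ((N:ℤ) + i)
  set F := ∏ i ∈ range (m+2), ((N:ℤ) - i)
  push_cast at a b c
  have h0 : ((m:ℤ)+2) * (m+3) ≠ 0 := by positivity
  apply mul_left_cancel₀ h0
  linear_combination (m+2) * c - (2*m+5) * N * b - (m+3) * ((m+2)^2 - (N:ℤ)^2) * a

theorem p_neg (n : ℕ) (z : ℤ) : p n (-z) = (-1)^(n+1) * p n z := by
  unfold p
  rw [Finset.mul_sum]
  refine Finset.sum_congr rfl fun g hg => ?_
  rw [Finset.mem_range] at hg
  have : (-1 : ℤ)^(n+1) = (-1)^(n+1-2*g) := by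
    obtain ⟨d, hd⟩ : ∃ d, n + 1 = d + 2 * g := ⟨n+1-2*g, by omega⟩
    rw [hd, Nat.add_sub_cancel, pow_add, pow_mul]; simp
  rw [neg_pow, this]; ring

theorem p_at_zero (n : ℕ) : p n 0 = 0 := by
  unfold p
  refine Finset.sum_eq_zero fun g hg => ?_
  rw [Finset.mem_range] at hg
  rw [zero_pow (by omega), mul_zero]

theorem rec_all (m : ℕ) (z : ℤ) :
    ((m:ℤ) + 4) * p (m+2) z = (2 * m + 5) * z * p (m+1) z + (m + 1) * ((m+2)^2 - z^2) * p m z := by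
  rcases eq_or_ne z 0 with rfl | hz
  · simp [p_at_zero]
  · have : NeZero z.natAbs := ⟨by simpa using hz⟩
    have h := rec_pos (N := z.natAbs) m
    rcases Int.natAbs_eq z with h1 | h1
    · rw [h1]; exact h
    · rw [h1, p_neg, p_neg, p_neg]
      simp only [pow_succ]
      linear_combination (-(-1)^m) * h

theorem p_init (z : ℤ) : p 0 z = z ∧ p 1 z = z ^ 2 := by
  have a0 : ∀ π : Perm (Fin 0), A 0 π = 1 := by
    intro π
    obtain ⟨g, hg, h⟩ := (A_spec π).2
    rw [Finset.mem_range] at hg; omega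
  have a1 : ∀ π : Perm (Fin 1), A 1 π = 2 := by
    intro π
    obtain ⟨g, hg, h⟩ := (A_spec π).2
    rw [Finset.mem_range] at hg; omega
  rw [p_eq, p_eq]
  simp [a0, a1]
end

/-- The recursion `(n+2) p_n(N) = (2n+1) N p_{n-1}(N) + (n-1)(n² - N²) p_{n-2}(N)` for the
Hultman polynomials, as an identity for every integer value of `N`, with initial values
`p_0(N) = N` and `p_1(N) = N²`. -/
theorem hultman_polynomial_recursion :
    (∀ (n : ℕ), 2 ≤ n → ∀ N : ℤ,
      (n + 2 : ℤ) * p n N =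
        (2 * n + 1 : ℤ) * N * p (n - 1) N + ((n : ℤ) - 1) * ((n : ℤ) ^ 2 - N ^ 2) * p (n - 2) N) ∧
    (∀ N : ℤ, p 0 N = N) ∧ (∀ N : ℤ, p 1 N = N ^ 2) := by
  refine ⟨?_, fun N => (p_init N).1, fun N => (p_init N).2⟩
  intro n hn N
  obtain ⟨m, rfl⟩ : ∃ m, n = m + 2 := ⟨n - 2, by omega⟩
  have h := rec_all m N
  have e1 : m + 2 - 1 = m + 1 := by omega
  have e2 : m + 2 - 2 = m := by omega
  rw [e1, e2]
  push_cast
  linear_combination h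
end

section
/- For every g ≥ 1, (g+1)·H(2g, 1) = (2g)!; that is, the number of permutations in S_{2g} whose cycle graph has exactly one alternating cycle equals (2g)!/(g+1). (This is the lowest coefficient a_{g,2g} of the polynomial P_g(X) = (1−X)^{4g+1}·H_g(X).) -/
open Finset Equiv

lemma hu_upd {n : ℕ} (L : Matrix (Fin (n+1)) (Fin (n+1)) ℤ) (j : Fin (n+1)) :
    (∑ x, L.updateCol 0 (fun _ => 1) x) j = if j = 0 then ((n:ℤ)+1) else ∑ x, L x j := by
  have : (∑ x, L.updateCol 0 (fun _ => 1) x) j = ∑ x, L.updateCol 0 (fun _ => 1) x j :=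
    Finset.sum_apply _ _ _
  rw [this]
  simp only [Matrix.updateCol_apply]
  split_ifs <;> simp

lemma hu_detUpd {n : ℕ} (L : Matrix (Fin (n+1)) (Fin (n+1)) ℤ) (hL : ∀ j, ∑ i, L i j = 0) :
    (L.updateCol 0 (fun _ => 1)).det = (n+1) * (L.submatrix Fin.succ Fin.succ).det := by
  set M := L.updateCol 0 (fun _ => 1) with hM
  have h1 : M.det = (M.updateRow 0 (∑ k, (fun _ => (1:ℤ)) k • M k)).det := by
    rw [Matrix.det_updateRow_sum]; simp
  rw [h1, Matrix.det_succ_row_zero, Finset.sum_eq_single 0]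
  · have : (M.updateRow 0 (∑ k, (fun _ => (1:ℤ)) k • M k)).submatrix Fin.succ (Fin.succAbove 0)
        = L.submatrix Fin.succ Fin.succ := by
      ext i j
      simp [hM, Matrix.updateRow_apply, Matrix.updateCol_apply]
    rw [this]
    simp [hM, hu_upd]
  · intro j _ hj
    have : (M.updateRow 0 (∑ k, (fun _ => (1:ℤ)) k • M k)) 0 j = 0 := by
      simp [hM, Matrix.updateRow_apply, hu_upd, hj, hL]
    rw [this]; simp
  · simp

/-- the matrix 1 - P_c with first row and column removed -/
def hu_L {n : ℕ} (c : Perm (Fin (n+1))) : Matrix (Fin (n+1)) (Fin (n+1)) ℤ :=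
  fun i j => (if i = j then 1 else 0) - (if c i = j then 1 else 0)

lemma hu_closed {n : ℕ} (c : Perm (Fin (n+1))) (h : ∀ x, c.SameCycle 0 x) (S : Set (Fin (n+1)))
    (h0 : (0 : Fin (n+1)) ∉ S) (hS : ∀ x ∈ S, c⁻¹ x ∈ S) (x : Fin (n+1)) : x ∉ S := by
  intro hx
  have h1 : (c⁻¹).SameCycle x 0 := by
    rw [Perm.sameCycle_inv]; exact (h x).symm
  obtain ⟨i, -, hi⟩ := h1.exists_pow_eq'
  have : ∀ k : ℕ, ((c⁻¹)^k) x ∈ S := by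
    intro k
    induction k with
    | zero => simpa using hx
    | succ k ih => rw [pow_succ', Perm.mul_apply]; exact hS _ ih
  have h2 := this i
  rw [hi] at h2
  exact h0 h2

lemma hu_det_one {n : ℕ} (c : Perm (Fin (n+1))) (h : ∀ x, c.SameCycle 0 x) :
    ((hu_L c).submatrix Fin.succ Fin.succ).det = 1 := by
  rw [Matrix.det_apply, Finset.sum_eq_single 1]
  · simp only [Perm.sign_one, one_smul, Perm.one_apply]
    apply Finset.prod_eq_one
    intro i _
    have := hu_closed c h {i.succ} (by simp [Fin.succ_ne_zero, eq_comm])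
    have h2 : c i.succ ≠ i.succ := by
      intro h3
      refine this ?_ i.succ rfl
      rintro x rfl
      show c⁻¹ i.succ = i.succ
      rw [Perm.inv_eq_iff_eq, h3]
    simp [hu_L, h2]
  · intro σ _ hσ
    by_contra hne
    have hp : ∀ i, ((hu_L c).submatrix Fin.succ Fin.succ) (σ i) i ≠ 0 := by
      intro i hi
      apply hne
      have : ∏ i, ((hu_L c).submatrix Fin.succ Fin.succ) (σ i) i = 0 :=
        Finset.prod_eq_zero (Finset.mem_univ i) hi
      rw [this]; simp
    apply hσ
    ext1 i
    by_contra hi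
    refine hu_closed c h {x | ∃ i, σ i ≠ i ∧ x = Fin.succ i} ?_ ?_ i.succ ⟨i, hi, rfl⟩
    · rintro ⟨i, _, h⟩
      exact Fin.succ_ne_zero i h.symm
    · rintro _ ⟨i, hi, rfl⟩
      have h3 := hp i
      simp only [hu_L, Matrix.submatrix_apply, Fin.succ_inj, if_neg hi] at h3
      have h4 : c (σ i).succ = i.succ := by
        by_contra h5; simp [h5] at h3
      refine ⟨σ i, fun h => hi (σ.injective h), ?_⟩
      rw [Perm.inv_eq_iff_eq, h4]
  · simp

lemma hu_det_zero {n : ℕ} (c : Perm (Fin (n+1))) (h : ¬ ∀ x, c.SameCycle 0 x) :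
    ((hu_L c).submatrix Fin.succ Fin.succ).det = 0 := by
  classical
  push Not at h
  obtain ⟨x, hx⟩ := h
  rw [← Matrix.exists_mulVec_eq_zero_iff]
  refine ⟨fun j => if c.SameCycle 0 j.succ then 0 else 1, ?_, ?_⟩
  · intro h
    cases x using Fin.cases with
    | zero => exact hx (Perm.SameCycle.refl _ _)
    | succ x => have := congrFun h x; simp [hx] at this
  · ext i
    have h1 : ∑ j : Fin (n+1), hu_L c i.succ j * (if c.SameCycle 0 j then 0 else 1) = 0 := by
      simp only [hu_L, sub_mul, ite_mul, one_mul, zero_mul, Finset.sum_sub_distrib]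
      simp
    rw [Fin.sum_univ_succ] at h1
    rw [if_pos (Perm.SameCycle.refl _ _)] at h1
    simpa [Matrix.mulVec, dotProduct] using h1

def hu_ph {n : ℕ} (π : Perm (Fin n)) : Perm (Fin (n+1)) :=
  Equiv.Perm.decomposeFin.symm (0, π)

def hu_c {n : ℕ} (π : Perm (Fin n)) : Perm (Fin (n+1)) :=
  (Equiv.addRight (1 : Fin (n+1))).trans
    ((hu_ph π).symm.trans ((Equiv.subRight (1 : Fin (n+1))).trans (hu_ph π)))

lemma hu_c_eq {n : ℕ} (π : Perm (Fin n)) : (cpi π : Perm (ZMod (n+1))) = hu_c π := rfl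

lemma hu_A (n : ℕ) (π : Perm (Fin n)) : A n π = 1 ↔ ∀ x, (hu_c π).SameCycle (0 : Fin (n+1)) x := by
  unfold A
  rw [Nat.card_eq_one_iff_unique]
  constructor
  · rintro ⟨h, -⟩ x
    have := Quotient.exact (h.elim (Quotient.mk (MulAction.orbitRel (Subgroup.zpowers (cpi π)) (ZMod (n+1))) x) (Quotient.mk _ 0))
    obtain ⟨⟨_, i, rfl⟩, hi⟩ := this
    exact ⟨i, hi⟩
  · intro h
    refine ⟨⟨?_⟩, ⟨Quotient.mk _ 0⟩⟩
    have : ∀ q : MulAction.orbitRel.Quotient (Subgroup.zpowers (cpi π)) (ZMod (n+1)), q = Quotient.mk _ 0 := by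
      intro q
      induction q using Quotient.inductionOn with
      | h x =>
        apply Quotient.sound
        obtain ⟨i, hi⟩ := h x
        exact ⟨⟨_, i, rfl⟩, hi⟩
    intro a b
    rw [this a, this b]

lemma hu_pihat_succ {n : ℕ} (π : Perm (Fin n)) (i : Fin n) :
    hu_ph π i.succ = (π i).succ := by
  have := Equiv.Perm.decomposeFin_symm_apply_succ π 0 i
  rw [Equiv.swap_self] at this
  exact this

def hu_M {n : ℕ} (Q : Perm (Fin n)) : Matrix (Fin n) (Fin n) ℤ :=
  fun i j => (if (i : ℕ) = j + 1 then 1 else 0) - (if (Q i : ℕ) = Q j + 1 then 1 else 0)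

lemma hu_sub_one {n : ℕ} (i j : Fin n) : (i.succ - 1 : Fin (n+1)) = j.succ ↔ (i:ℕ) = j + 1 := by
  rw [sub_eq_iff_eq_add]
  cases n with
  | zero => exact i.elim0
  | succ n =>
    rw [Fin.ext_iff, Fin.val_add]
    have := i.2; have := j.2
    simp
    rcases Nat.lt_or_ge (j+1+1) (n+1+1) with h | h
    · rw [Nat.mod_eq_of_lt h]; omega
    · have : (j:ℕ)+1+1 = n+1+1 := by omega
      rw [this, Nat.mod_self]; omega

lemma hu_pihat_sub {n : ℕ} (π : Perm (Fin n)) (i j : Fin n) :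
    hu_ph π ((hu_ph π).symm i.succ - 1) = j.succ ↔
      (π⁻¹ i : ℕ) = π⁻¹ j + 1 := by
  have h : ∀ i : Fin n, (hu_ph π).symm i.succ = (π⁻¹ i).succ := by
    intro i
    rw [Equiv.symm_apply_eq, hu_pihat_succ]; simp
  rw [← Equiv.eq_symm_apply, h, h]
  exact hu_sub_one _ _

lemma hu_det_eq {n : ℕ} (hn : Even n) (π : Perm (Fin n)) :
    ((hu_L (hu_c π)).submatrix Fin.succ Fin.succ).det = (hu_M π⁻¹).det := by
  let s : Perm (Fin (n+1)) := finRotate (n+1)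
  let t : Perm (Fin (n+1)) := (hu_ph π).symm.trans ((Equiv.subRight (1 : Fin (n+1))).trans (hu_ph π))
  let K : Matrix (Fin (n+1)) (Fin (n+1)) ℤ :=
    fun i j => (if s⁻¹ i = j then 1 else 0) - (if t i = j then 1 else 0)
  have hK : ∀ i j, K i j = (if s⁻¹ i = j then 1 else 0) - (if t i = j then 1 else 0) := fun _ _ => rfl
  have hs : ∀ i, s i = i + 1 := fun i => by simp [s]
  have hc : ∀ i, (hu_c π) i = t (s i) := by
    intro i; rw [hs]; rfl
  have hsum : ∀ c : Perm (Fin (n+1)), ∀ j, ∑ i, (if c i = j then (1:ℤ) else 0) = 1 := by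
    intro c j
    have : ∀ i, (c i = j ↔ i = c⁻¹ j) := fun i => by rw [Perm.eq_inv_iff_eq]
    simp [this]
  have h1 := hu_detUpd (hu_L (hu_c π)) (by
    intro j
    simp only [hu_L, Finset.sum_sub_distrib]
    rw [hsum]; simp)
  have h2 := hu_detUpd K (by
    intro j
    simp only [K, Finset.sum_sub_distrib]
    rw [hsum, hsum]; simp)
  have h3 : ((K.updateCol 0 (fun _ => 1)).submatrix s id) =
      (hu_L (hu_c π)).updateCol 0 (fun _ => 1) := by
    ext i j
    rw [Matrix.submatrix_apply, Matrix.updateCol_apply, Matrix.updateCol_apply, hK]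
    simp [hu_L, hc]
  have h4 := Matrix.det_permute s (K.updateCol 0 (fun _ => 1))
  rw [h3, h1, h2, sign_finRotate, Nat.add_sub_cancel, hn.neg_one_pow] at h4
  have h5 : K.submatrix Fin.succ Fin.succ = hu_M π⁻¹ := by
    ext i j
    rw [Matrix.submatrix_apply, hK]
    unfold hu_M
    congr 2
    · have : s⁻¹ i.succ = i.succ - 1 := by
        rw [Perm.inv_eq_iff_eq, hs]; simp
      rw [this, hu_sub_one]
    · exact propext (hu_pihat_sub π i j)
  rw [h5] at h4
  have : (n:ℤ)+1 ≠ 0 := by positivity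
  simp at h4
  tauto

lemma hu_H {n : ℕ} (hn : Even n) : (H n 1 : ℤ) = ∑ Q : Perm (Fin n), (hu_M Q).det := by
  classical
  have h : ∀ π : Perm (Fin n), (hu_M π⁻¹).det = if A n π = 1 then 1 else 0 := by
    intro π
    rw [← hu_det_eq hn]
    split_ifs with h
    · exact hu_det_one _ ((hu_A n π).1 h)
    · exact hu_det_zero _ (fun h' => h ((hu_A n π).2 h'))
  rw [← Equiv.sum_comp (Equiv.inv (Perm (Fin n)))]
  simp only [Equiv.inv_apply, h]
  rw [H, Nat.card_eq_fintype_card, Fintype.card_subtype]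
  simp

/-- validity of a triple -/
def hu_V {n : ℕ} (I : Finset (Fin n)) (σ Q : Perm (Fin n)) : Prop :=
  (∀ i, i ∉ I → (σ i : ℕ) = i + 1) ∧ (∀ i ∈ I, (Q (σ i) : ℕ) = Q i + 1)

def hu_B {n : ℕ} (I : Finset (Fin n)) (σ : Perm (Fin n)) : Finset (Fin n) := I.image σ \ I

open Classical in
lemma hu_expand {n : ℕ} (Q : Perm (Fin n)) :
    (hu_M Q).det = ∑ σ : Perm (Fin n), ∑ I : Finset (Fin n),
      if hu_V I σ Q then ((Perm.sign σ : ℤ) * (-1) ^ I.card) else 0 := by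
  rw [Matrix.det_apply']
  refine Finset.sum_congr rfl fun σ _ => ?_
  have h : ∀ i, hu_M Q (σ i) i = (-(if (Q (σ i) : ℕ) = Q i + 1 then 1 else 0)) +
      (if (σ i : ℕ) = i + 1 then 1 else 0) := by
    intro i; unfold hu_M; ring
  simp only [h]
  rw [Finset.prod_add, Finset.mul_sum]
  simp only [Finset.powerset_univ]
  refine Finset.sum_congr rfl fun I _ => ?_
  rw [Finset.prod_neg, Finset.prod_boole, Finset.prod_boole]
  unfold hu_V
  by_cases h1 : ∀ i ∈ I, (Q (σ i) : ℕ) = Q i + 1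
  · by_cases h2 : ∀ i, i ∉ I → (σ i : ℕ) = i + 1
    · rw [if_pos h1, if_pos (by simpa using h2), if_pos ⟨h2, h1⟩]; simp
    · have h3 : ¬ ∀ i ∈ univ \ I, (σ i : ℕ) = i + 1 := by simpa using h2
      have h4 : ¬ ((∀ i, i ∉ I → (σ i : ℕ) = i + 1) ∧ ∀ i ∈ I, (Q (σ i) : ℕ) = Q i + 1) :=
        fun h => h2 h.1
      rw [if_neg h3, if_neg h4]; simp
  · have h4 : ¬ ((∀ i, i ∉ I → (σ i : ℕ) = i + 1) ∧ ∀ i ∈ I, (Q (σ i) : ℕ) = Q i + 1) :=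
        fun h => h1 h.2
    rw [if_neg h1, if_neg h4]; simp

open Classical in
lemma hu_cancel {n : ℕ} (I : Finset (Fin n)) :
    ∑ p : Perm (Fin n) × Perm (Fin n) with (hu_V I p.1 p.2 ∧ 1 < (hu_B I p.1).card),
      (Perm.sign p.1 : ℤ) = 0 := by
  have hex : ∀ B : Finset (Fin n), ∃ τ : Perm (Fin n), 1 < B.card →
      ∃ x y, x ∈ B ∧ y ∈ B ∧ x ≠ y ∧ τ = swap x y := by
    intro B
    by_cases h : 1 < B.card
    · obtain ⟨x, hx, y, hy, hxy⟩ := Finset.one_lt_card.1 h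
      exact ⟨swap x y, fun _ => ⟨x, y, hx, hy, hxy, rfl⟩⟩
    · exact ⟨1, fun h' => absurd h' h⟩
  choose t ht using hex
  have key : ∀ σ : Perm (Fin n), 1 < (hu_B I σ).card →
      t (hu_B I σ) * t (hu_B I σ) = 1 ∧ (Perm.sign (t (hu_B I σ)) : ℤ) = -1 ∧
      (∀ x ∈ I, t (hu_B I σ) x = x) ∧ (∀ x ∉ I, t (hu_B I σ) (σ x) = σ x) ∧
      hu_B I (t (hu_B I σ) * σ) = hu_B I σ := by
    intro σ h
    obtain ⟨x, y, hx, hy, hxy, hτ⟩ := ht _ h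
    rw [hτ]
    have hx' : (∃ z ∈ I, σ z = x) ∧ x ∉ I := by simpa [hu_B] using hx
    have hy' : (∃ z ∈ I, σ z = y) ∧ y ∉ I := by simpa [hu_B] using hy
    obtain ⟨⟨x1, hx1, hx1'⟩, hx2⟩ := hx'
    obtain ⟨⟨y1, hy1, hy1'⟩, hy2⟩ := hy'
    have h4 : ∀ z ∉ I, swap x y (σ z) = σ z := by
      intro z hz
      apply Equiv.swap_apply_of_ne_of_ne
      · rintro h; rw [← hx1'] at h; exact hz (σ.injective h ▸ hx1)
      · rintro h; rw [← hy1'] at h; exact hz (σ.injective h ▸ hy1)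
    refine ⟨Equiv.swap_mul_self _ _, by rw [Perm.sign_swap hxy]; rfl, ?_, h4, ?_⟩
    · intro z hz
      apply Equiv.swap_apply_of_ne_of_ne
      · rintro rfl; exact hx2 hz
      · rintro rfl; exact hy2 hz
    · have : I.image (swap x y * σ) = I.image σ := by
        apply Finset.eq_of_subset_of_card_le
        · intro w hw
          rw [Finset.mem_image] at hw
          obtain ⟨z, hz, rfl⟩ := hw
          rw [Perm.mul_apply]
          by_contra hc
          have h5 : σ⁻¹ (swap x y (σ z)) ∉ I := fun h => hc (Finset.mem_image.2 ⟨_, h, by simp⟩)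
          have h6 := h4 _ h5
          simp at h6
          rw [← h6] at h5
          simp at h5
          exact h5 hz
        · rw [Finset.card_image_of_injective _ σ.injective,
            Finset.card_image_of_injective _ (swap x y * σ).injective]
      unfold hu_B
      rw [this]
  refine Finset.sum_involution
    (fun p _ => (t (hu_B I p.1) * p.1, p.2 * t (hu_B I p.1))) ?_ ?_ ?_ ?_
  · rintro ⟨σ, Q⟩ hp
    simp only [Finset.mem_filter, Finset.mem_univ, true_and] at hp
    obtain ⟨k1, k2, k3, k4, k5⟩ := key σ hp.2
    simp only [Perm.sign_mul, Units.val_mul, k2]; ring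
  · rintro ⟨σ, Q⟩ hp _ h
    simp only [Finset.mem_filter, Finset.mem_univ, true_and] at hp
    obtain ⟨k1, k2, k3, k4, k5⟩ := key σ hp.2
    have h1 : t (hu_B I σ) * σ = σ := congrArg Prod.fst h
    have h2 : t (hu_B I σ) = 1 := by simpa using h1
    rw [h2] at k2; simp at k2
  · rintro ⟨σ, Q⟩ hp
    simp only [Finset.mem_filter, Finset.mem_univ, true_and] at hp ⊢
    obtain ⟨k1, k2, k3, k4, k5⟩ := key σ hp.2
    rw [k5]
    refine ⟨⟨?_, ?_⟩, hp.2⟩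
    · intro i hi
      rw [Perm.mul_apply, k4 i hi]; exact hp.1.1 i hi
    · intro i hi
      have : ∀ z, t (hu_B I σ) (t (hu_B I σ) z) = z := fun z => by
        rw [← Perm.mul_apply, k1]; rfl
      simp only [Perm.mul_apply, this, k3 i hi]
      exact hp.1.2 i hi
  · rintro ⟨σ, Q⟩ hp
    simp only [Finset.mem_filter, Finset.mem_univ, true_and] at hp
    obtain ⟨k1, k2, k3, k4, k5⟩ := key σ hp.2
    simp only [k5, mul_assoc, k1, mul_one]
    rw [← mul_assoc, k1, one_mul]

lemma hu_sign {m : ℕ} (σ : Perm (Fin (m+1))) (ρ : Fin (m+1) → ZMod (m+1))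
    (h : ∀ x, ρ (σ x) = ρ x + 1) : Perm.sign σ = (-1) ^ m := by
  have hs : Function.Surjective ρ := by
    have h1 : ∀ k : ℕ, ∃ x, ρ x = ρ 0 + (k : ZMod (m+1)) := by
      intro k
      induction k with
      | zero => exact ⟨0, by simp⟩
      | succ k ih =>
        obtain ⟨x, hx⟩ := ih
        exact ⟨σ x, by rw [h, hx]; push_cast; ring⟩
    intro y
    obtain ⟨x, hx⟩ := h1 (y - ρ 0).val
    exact ⟨x, by rw [hx]; simp⟩
  let e : Perm (Fin (m+1)) := Equiv.ofBijective ρ (by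
    exact Finite.surjective_iff_bijective (α := Fin (m+1)).1 hs)
  have : e * σ = finRotate (m+1) * e := by
    ext1 x
    rw [Perm.mul_apply, Perm.mul_apply, finRotate_apply]
    exact h x
  have h2 := congrArg Perm.sign this
  rw [Perm.sign_mul, Perm.sign_mul, sign_finRotate, mul_comm] at h2
  simpa using h2

def hu_good {n : ℕ} (a b : Fin n) (Q : Perm (Fin n)) : Prop :=
  b < a ∧ ∀ x, ¬ (b ≤ x ∧ x < a) ↔ (Q a ≤ Q x ∧ Q x < Q b)

lemma hu_good_card {n : ℕ} {a b : Fin n} {Q : Perm (Fin n)} (h : hu_good a b Q) :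
    Q a < Q b ∧ ((Q b : ℕ) - Q a) + ((a : ℕ) - b) = n := by
  obtain ⟨hba, h⟩ := h
  have h0 := (h a).1 (by simp)
  refine ⟨h0.2, ?_⟩
  have h1 : ((Finset.Ico b a)ᶜ).map Q.toEmbedding = Finset.Ico (Q a) (Q b) := by
    ext y
    simp only [Finset.mem_map, Finset.mem_compl, Finset.mem_Ico, h]
    constructor
    · rintro ⟨x, hx, rfl⟩; exact hx
    · intro hy; exact ⟨Q.symm y, by simpa using hy, by simp⟩
  have h2 := congrArg Finset.card h1
  rw [Finset.card_map, Finset.card_compl, Fin.card_Ico, Fin.card_Ico, Fintype.card_fin] at h2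
  have := a.2
  omega

lemma hu_exists {n : ℕ} (hn : Even n) {a b : Fin n} {Q : Perm (Fin n)} (h : hu_good a b Q) :
    ∃ σ : Perm (Fin n), hu_V (Finset.Ico b a)ᶜ σ Q ∧ (hu_B (Finset.Ico b a)ᶜ σ).card ≤ 1 ∧
      (Perm.sign σ : ℤ) = -1 := by
  obtain ⟨hlt, hcard⟩ := hu_good_card h
  obtain ⟨hba, h⟩ := h
  have hK : ∀ x, (b ≤ x ∧ x < a) → (x : ℕ) + 1 < n := by
    intro x hx
    have := a.2
    have := hx.2
    rw [Fin.lt_def] at this; omega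
  have hI : ∀ x, ¬ (b ≤ x ∧ x < a) → (Q x : ℕ) + 1 < n := by
    intro x hx
    have := (Q b).2
    have := ((h x).1 hx).2
    rw [Fin.lt_def] at this; omega
  let f : Fin n → Fin n := fun x => if hx : b ≤ x ∧ x < a then ⟨x + 1, hK x hx⟩
    else Q.symm ⟨Q x + 1, hI x hx⟩
  have f1 : ∀ x, (b ≤ x ∧ x < a) → (f x : ℕ) = x + 1 := by
    intro x hx; simp only [f, dif_pos hx]
  have f2 : ∀ x, ¬ (b ≤ x ∧ x < a) → (Q (f x) : ℕ) = Q x + 1 := by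
    intro x hx; simp only [f, dif_neg hx]; simp
  have f3 : ∀ x, ¬ (b ≤ x ∧ x < a) → (b ≤ f x ∧ f x < a) → f x = b := by
    intro x hx hfx
    have h1 := (h x).1 hx
    have h2 := f2 x hx
    have h3 : ¬ (Q a ≤ Q (f x) ∧ Q (f x) < Q b) := by rw [← h]; simpa using hfx
    apply Q.injective
    simp only [Fin.le_def, Fin.lt_def, Fin.ext_iff] at *
    omega
  have f4 : ∀ x y, (b ≤ x ∧ x < a) → ¬ (b ≤ y ∧ y < a) → f x ≠ f y := by
    intro x y hx hy hxy
    have h1 := f1 x hx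
    by_cases h2 : b ≤ f y ∧ f y < a
    · have := f3 y hy h2
      rw [hxy, this] at h1
      have := hx.1
      rw [Fin.le_def] at this; omega
    · have h3 : f y = a := by
        rw [hxy] at h1
        simp only [Fin.le_def, Fin.lt_def, Fin.ext_iff] at *
        omega
      have h4 := f2 y hy
      rw [h3] at h4
      have := ((h y).1 hy).1
      rw [Fin.le_def] at this; omega
  have finj : Function.Injective f := by
    intro x y hxy
    by_cases hx : b ≤ x ∧ x < a <;> by_cases hy : b ≤ y ∧ y < a
    · have h1 := f1 x hx; have h2 := f1 y hy
      rw [hxy] at h1; apply Fin.ext; omega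
    · exact (f4 x y hx hy hxy).elim
    · exact (f4 y x hy hx hxy.symm).elim
    · have h1 := f2 x hx; have h2 := f2 y hy
      rw [hxy] at h1; apply Q.injective; apply Fin.ext; omega
  let σ : Perm (Fin n) := Equiv.ofBijective f (Finite.injective_iff_bijective.1 finj)
  have hσ : ∀ x, σ x = f x := fun _ => rfl
  refine ⟨σ, ⟨?_, ?_⟩, ?_, ?_⟩
  · intro i hi
    rw [hσ]; exact f1 i (by simpa using hi)
  · intro i hi
    rw [hσ]; exact f2 i (by simpa using hi)
  · have : Nonempty (Fin n) := ⟨a⟩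
    rw [Finset.card_le_one_iff_subset_singleton]
    refine ⟨b, ?_⟩
    intro y hy
    simp only [hu_B, Finset.mem_sdiff, Finset.mem_image, Finset.mem_compl, Finset.mem_Ico, not_not] at hy
    obtain ⟨⟨x, hx, rfl⟩, hy⟩ := hy
    rw [Finset.mem_singleton]
    exact f3 x hx hy
  · obtain ⟨m, rfl⟩ : ∃ m, n = m + 1 := ⟨n - 1, by have := a.2; omega⟩
    have hrel : ((Q b : ℕ) : ZMod (m+1)) - ((Q a : ℕ) : ZMod (m+1)) =
        ((b : ℕ) : ZMod (m+1)) - ((a : ℕ) : ZMod (m+1)) := by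
      have h1 : (Q b : ℕ) + a = (m+1) + b + Q a := by
        rw [Fin.lt_def] at hlt hba; omega
      have h2 := congrArg (Nat.cast : ℕ → ZMod (m+1)) h1
      push_cast at h2
      have h3 : (m : ZMod (m+1)) + 1 = 0 := by exact_mod_cast ZMod.natCast_self (m+1)
      rw [h3] at h2
      linear_combination h2
    let ρ : Fin (m+1) → ZMod (m+1) := fun x =>
      if b ≤ x ∧ x < a then ((x:ℕ) : ZMod (m+1)) - ((a : ℕ) : ZMod (m+1))
      else ((Q x : ℕ) : ZMod (m+1)) - ((Q a : ℕ) : ZMod (m+1))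
    have hρ : ∀ x, ρ (σ x) = ρ x + 1 := by
      intro x
      rw [hσ]
      by_cases hx : b ≤ x ∧ x < a
      · have h1 := f1 x hx
        by_cases hy : b ≤ f x ∧ f x < a
        · simp only [ρ, if_pos hx, if_pos hy, h1]; push_cast; ring
        · have h3 : f x = a := by
            simp only [Fin.le_def, Fin.lt_def, Fin.ext_iff] at *
            omega
          simp only [ρ, if_pos hx, if_neg hy]
          rw [h3] at h1 ⊢
          rw [h1]; push_cast; ring
      · have h1 := f2 x hx
        by_cases hy : b ≤ f x ∧ f x < a
        · have h3 := f3 x hx hy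
          simp only [ρ, if_neg hx, if_pos hy]
          rw [h3] at h1 ⊢
          rw [← hrel, h1]; push_cast; ring
        · simp only [ρ, if_neg hx, if_neg hy, h1]; push_cast; ring
    have := hu_sign σ ρ hρ
    rw [this]
    have hm : Odd m := by
      rcases Nat.even_or_odd m with h | h
      · exact absurd hn (by simpa using h.add_one)
      · exact h
    rw [hm.neg_one_pow]; rfl

lemma hu_struct {n : ℕ} (hn : 0 < n) (I : Finset (Fin n)) (σ Q : Perm (Fin n))
    (hV : hu_V I σ Q) (hB : (hu_B I σ).card ≤ 1) :
    ∃ a b, hu_good a b Q ∧ I = (Finset.Ico b a)ᶜ := by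
  obtain ⟨h1, h2⟩ := hV
  have hσi : ∀ x, σ (σ⁻¹ x) = x := fun x => by simp
  have hIne : I.Nonempty := by
    refine ⟨⟨n-1, by omega⟩, ?_⟩
    by_contra hc
    have := h1 _ hc
    have h3 := (σ ⟨n-1, by omega⟩).2
    simp at this; omega
  have hKne : (Iᶜ).Nonempty := by
    refine ⟨Q.symm ⟨n-1, by omega⟩, ?_⟩
    rw [Finset.mem_compl]
    intro hc
    have := h2 _ hc
    have h3 := (Q (σ (Q.symm ⟨n-1, by omega⟩))).2
    simp at this; omega
  obtain ⟨b, hbI, hb⟩ : ∃ b, b ∉ I ∧ ∀ x ∈ I, σ x ∈ I ∨ σ x = b := by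
    obtain ⟨x, hx, hmax⟩ := Finset.exists_max_image I Q hIne
    have hx' : σ x ∉ I := by
      intro hc
      have h3 := hmax _ hc
      have h4 := h2 x hx
      rw [Fin.le_def] at h3; omega
    refine ⟨σ x, hx', ?_⟩
    intro y hy
    by_contra hc
    push Not at hc
    apply hc.2
    rw [Finset.card_le_one] at hB
    apply hB
    · simp only [hu_B, Finset.mem_sdiff, Finset.mem_image]
      exact ⟨⟨y, hy, rfl⟩, hc.1⟩
    · simp only [hu_B, Finset.mem_sdiff, Finset.mem_image]
      exact ⟨⟨x, hx, rfl⟩, hx'⟩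
  have c2 : ∀ k : ℕ, ∀ x : Fin n, (x : ℕ) = k → x ∉ I → b ≤ x ∧ ∀ z, b ≤ z → z ≤ x → z ∉ I := by
    intro k
    induction k with
    | zero =>
      intro x hx hxI
      by_cases hxb : x = b
      · subst hxb
        refine ⟨le_rfl, fun z h3 h4 => ?_⟩
        rw [le_antisymm h4 h3]; exact hxI
      · exfalso
        have h3 : σ⁻¹ x ∉ I := by
          intro hc
          rcases hb _ hc with h | h <;> simp at h <;> contradiction
        have := h1 _ h3
        simp at this; omega
    | succ k ih =>
      intro x hx hxI
      by_cases hxb : x = b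
      · subst hxb
        refine ⟨le_rfl, fun z h3 h4 => ?_⟩
        rw [le_antisymm h4 h3]; exact hxI
      · have h3 : σ⁻¹ x ∉ I := by
          intro hc
          rcases hb _ hc with h | h <;> simp at h <;> contradiction
        have h4 := h1 _ h3
        rw [hσi] at h4
        obtain ⟨h5, h6⟩ := ih (σ⁻¹ x) (by omega) h3
        rw [Fin.le_def] at h5
        refine ⟨by rw [Fin.le_def]; omega, ?_⟩
        intro z hz1 hz2
        by_cases hzx : z = x
        · rw [hzx]; exact hxI
        · apply h6 z hz1
          have : (z : ℕ) ≠ x := fun h => hzx (Fin.ext h)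
          rw [Fin.le_def] at hz2 ⊢; omega
  obtain ⟨m, hm, hmax⟩ := Finset.exists_max_image (Iᶜ) id hKne
  rw [Finset.mem_compl] at hm
  have ha := h1 m hm
  have hKiff : ∀ x, x ∉ I ↔ b ≤ x ∧ x < σ m := by
    intro x
    constructor
    · intro hx
      refine ⟨(c2 _ x rfl hx).1, ?_⟩
      have := hmax x (by simpa using hx)
      simp only [id, Fin.le_def, Fin.lt_def] at *; omega
    · rintro ⟨h3, h4⟩
      refine (c2 _ m rfl hm).2 x h3 ?_
      simp only [Fin.le_def, Fin.lt_def] at *; omega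
  have c3 : ∀ k : ℕ, ∀ x : Fin n, n - (Q x : ℕ) ≤ k → x ∈ I →
      Q x < Q b ∧ ∀ y, Q x ≤ Q y → Q y < Q b → y ∈ I := by
    intro k
    induction k with
    | zero => intro x hx; have := (Q x).2; omega
    | succ k ih =>
      intro x hx hxI
      have h3 := h2 x hxI
      have hy : ∀ y, Q x ≤ Q y → Q y ≠ Q x → Q (σ x) ≤ Q y := by
        intro y h5 h6
        have : (Q y : ℕ) ≠ Q x := fun h => h6 (Fin.ext h)
        rw [Fin.le_def] at h5 ⊢; omega
      rcases hb x hxI with h | h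
      · obtain ⟨h4, h5⟩ := ih (σ x) (by have := (Q (σ x)).2; omega) h
        refine ⟨by rw [Fin.lt_def] at h4 ⊢; omega, ?_⟩
        intro y hy1 hy2
        by_cases h6 : Q y = Q x
        · rw [Q.injective h6]; exact hxI
        · exact h5 y (hy y hy1 h6) hy2
      · rw [h] at h3 hy
        refine ⟨by rw [Fin.lt_def]; omega, ?_⟩
        intro y hy1 hy2
        by_cases h6 : Q y = Q x
        · rw [Q.injective h6]; exact hxI
        · exact absurd hy2 (not_lt.2 (hy y hy1 h6))
  obtain ⟨x0, hx0, hmin⟩ := Finset.exists_min_image I Q hIne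
  have hx0a : x0 = σ m := by
    have h3 : σ⁻¹ x0 ∉ I := by
      intro hc
      have h4 := h2 _ hc
      have h5 := hmin _ hc
      rw [hσi] at h4
      rw [Fin.le_def] at h5; omega
    have h4 := h1 _ h3
    rw [hσi] at h4
    have h5 := (hKiff _).1 h3
    have h6 : ¬ (b ≤ x0 ∧ x0 < σ m) := by rw [← hKiff]; simpa using hx0
    simp only [Fin.le_def, Fin.lt_def, Fin.ext_iff] at *
    omega
  refine ⟨σ m, b, ⟨?_, ?_⟩, ?_⟩
  · have := ((hKiff m).1 hm).1
    rw [Fin.le_def] at this; rw [Fin.lt_def]; omega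
  · intro x
    rw [← hKiff, not_not, ← hx0a]
    constructor
    · intro hx
      exact ⟨hmin x hx, (c3 _ x le_rfl hx).1⟩
    · rintro ⟨h3, h4⟩
      exact (c3 _ x0 le_rfl hx0).2 x h3 h4
  · ext x
    rw [Finset.mem_compl, Finset.mem_Ico, ← hKiff, not_not]

open Classical in
lemma hu_total {n : ℕ} (hn : Even n) (hpos : 0 < n) :
    ∑ Q : Perm (Fin n), (hu_M Q).det =
      ∑ t : Fin n × Fin n × Perm (Fin n) with hu_good t.1 t.2.1 t.2.2,
        (-1 : ℤ) ^ ((t.1 : ℕ) - t.2.1 + 1) := by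
  have e1 : ∑ Q : Perm (Fin n), (hu_M Q).det = ∑ I : Finset (Fin n),
      (∑ p : Perm (Fin n) × Perm (Fin n) with hu_V I p.1 p.2, (Perm.sign p.1 : ℤ)) * (-1) ^ I.card := by
    simp only [hu_expand]
    simp only [Finset.sum_filter, Finset.sum_mul, Fintype.sum_prod_type, ite_mul, zero_mul]
    rw [Finset.sum_comm]
    rw [Finset.sum_comm' (t' := Finset.univ) (s' := fun _ => Finset.univ) (by simp)]
    rw [Finset.sum_comm]
    conv_rhs => rw [Finset.sum_comm]
    refine Finset.sum_congr rfl fun σ _ => ?_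
    rw [Finset.sum_comm]
  have e2 : ∀ I : Finset (Fin n),
      (∑ p : Perm (Fin n) × Perm (Fin n) with hu_V I p.1 p.2, (Perm.sign p.1 : ℤ)) =
      ∑ p : Perm (Fin n) × Perm (Fin n) with (hu_V I p.1 p.2 ∧ (hu_B I p.1).card ≤ 1),
        (Perm.sign p.1 : ℤ) := by
    intro I
    rw [← Finset.sum_filter_add_sum_filter_not (Finset.univ.filter fun p : Perm (Fin n) × Perm (Fin n) => hu_V I p.1 p.2)
      (fun p => (hu_B I p.1).card ≤ 1), Finset.filter_filter, Finset.filter_filter]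
    simp only [not_le]
    rw [hu_cancel, add_zero]
  have e3 : ∑ Q : Perm (Fin n), (hu_M Q).det =
      ∑ t : Finset (Fin n) × Perm (Fin n) × Perm (Fin n) with
        (hu_V t.1 t.2.1 t.2.2 ∧ (hu_B t.1 t.2.1).card ≤ 1), (Perm.sign t.2.1 : ℤ) * (-1) ^ t.1.card := by
    rw [e1]
    simp only [e2]
    simp only [Finset.sum_filter, Finset.sum_mul, ite_mul, zero_mul]
    rw [Fintype.sum_prod_type (f := fun t : Finset (Fin n) × Perm (Fin n) × Perm (Fin n) => if hu_V t.1 t.2.1 t.2.2 ∧ (hu_B t.1 t.2.1).card ≤ 1 then (Perm.sign t.2.1 : ℤ) * (-1) ^ t.1.card else 0)]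
  rw [e3]
  symm
  have hgd : ∀ t : Fin n × Fin n × Perm (Fin n), t ∈ (Finset.univ.filter fun t : Fin n × Fin n × Perm (Fin n) => hu_good t.1 t.2.1 t.2.2) → hu_good t.1 t.2.1 t.2.2 := by
    intro t ht; simpa using ht
  refine Finset.sum_bij
    (fun t ht => ((Finset.Ico t.2.1 t.1)ᶜ, (hu_exists hn (hgd t ht)).choose, t.2.2)) ?_ ?_ ?_ ?_
  · intro t ht
    have := (hu_exists hn (hgd t ht)).choose_spec
    rw [Finset.mem_filter]
    exact ⟨Finset.mem_univ _, this.1, this.2.1⟩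
  · rintro ⟨a, b, Q⟩ ht ⟨a', b', Q'⟩ ht' h
    simp only [Prod.mk.injEq] at h
    obtain ⟨h1, -, rfl⟩ := h
    have g1 := (hgd _ ht).1
    have g2 := (hgd _ ht').1
    simp only at g1 g2
    have h2 : ∀ x, (b ≤ x ∧ x < a) ↔ (b' ≤ x ∧ x < a') := by
      intro x
      rw [← Finset.mem_Ico, ← Finset.mem_Ico, compl_injective h1]
    have k1 := (h2 b).1 ⟨le_rfl, g1⟩
    have k2 := (h2 b').2 ⟨le_rfl, g2⟩
    have hb : b = b' := le_antisymm k2.1 k1.1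
    subst hb
    have ha : a = a' := by
      rcases lt_trichotomy a a' with h | h | h
      · exact absurd ((h2 a).2 ⟨g1.le, h⟩).2 (lt_irrefl _)
      · exact h
      · exact absurd ((h2 a').1 ⟨g2.le, h⟩).2 (lt_irrefl _)
    rw [ha]
  · rintro ⟨I, σ, Q⟩ ht
    rw [Finset.mem_filter] at ht
    obtain ⟨-, hV, hB⟩ := ht
    obtain ⟨a, b, hg, hI⟩ := hu_struct hpos I σ Q hV hB
    simp only at hV hB hI
    have hmem : (a, b, Q) ∈ (Finset.univ.filter fun t : Fin n × Fin n × Perm (Fin n) => hu_good t.1 t.2.1 t.2.2) := by simpa using hg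
    refine ⟨(a, b, Q), hmem, ?_⟩
    have hs := (hu_exists hn (hgd _ hmem)).choose_spec
    refine Prod.ext hI.symm (Prod.ext ?_ rfl)
    simp only
    generalize (hu_exists hn (hgd _ hmem)).choose = τ at hs
    obtain ⟨⟨h1, h2⟩, -, -⟩ := hs
    simp only at h1 h2
    rw [← hI] at h1 h2
    ext1 x
    by_cases hx : x ∈ I
    · apply Q.injective; apply Fin.ext
      rw [h2 x hx, hV.2 x hx]
    · apply Fin.ext
      rw [h1 x hx, hV.1 x hx]
  · rintro ⟨a, b, Q⟩ ht
    have hs := (hu_exists hn (hgd _ ht)).choose_spec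
    simp only
    rw [hs.2.2, Finset.card_compl, Fin.card_Ico, Fintype.card_fin]
    have := a.2
    have h1 : (-1 : ℤ) ^ (n - ((a:ℕ) - b)) = (-1) ^ ((a:ℕ) - b) := by
      have h2 : (-1 : ℤ) ^ (n - ((a:ℕ) - b)) * (-1) ^ ((a:ℕ) - b) = 1 := by
        rw [← pow_add, Nat.sub_add_cancel (by omega), hn.neg_one_pow]
      rcases neg_one_pow_eq_or ℤ ((a:ℕ) - b) with h | h <;> rw [h] at h2 ⊢ <;> linarith
    rw [h1, pow_succ]; ring

def hu_col {n : ℕ} (v w y : Fin n) : Fin 4 :=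
  if y = v then 0 else if y = w then 1 else if v < y ∧ y < w then 2 else 3

lemma hu_col_card {n : ℕ} {v w : Fin n} (h : v < w) :
    Fintype.card {y // hu_col v w y = 0} = 1 ∧ Fintype.card {y // hu_col v w y = 1} = 1 ∧
    Fintype.card {y // hu_col v w y = 2} = (w:ℕ) - v - 1 ∧
    Fintype.card {y // hu_col v w y = 3} = n - ((w:ℕ) - v) - 1 := by
  simp only [Fintype.card_subtype]
  have h0 : (Finset.univ.filter fun y => hu_col v w y = 0) = {v} := by
    ext y; simp [hu_col]; split_ifs <;> simp_all
  have h1 : (Finset.univ.filter fun y => hu_col v w y = 1) = {w} := by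
    ext y; rw [Finset.mem_filter]; simp only [hu_col, Finset.mem_univ, true_and, Finset.mem_singleton, Finset.mem_Ioo, Finset.mem_compl, Finset.mem_Icc]; split_ifs <;> simp <;> grind
  have h2 : (Finset.univ.filter fun y => hu_col v w y = 2) = Finset.Ioo v w := by
    ext y; rw [Finset.mem_filter]; simp only [hu_col, Finset.mem_univ, true_and, Finset.mem_singleton, Finset.mem_Ioo, Finset.mem_compl, Finset.mem_Icc]; split_ifs <;> simp <;> grind
  have h3 : (Finset.univ.filter fun y => hu_col v w y = 3) = (Finset.Icc v w)ᶜ := by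
    ext y; rw [Finset.mem_filter]; simp only [hu_col, Finset.mem_univ, true_and, Finset.mem_singleton, Finset.mem_Ioo, Finset.mem_compl, Finset.mem_Icc]; split_ifs <;> simp <;> grind
  rw [h0, h1, h2, h3, Finset.card_compl, Fin.card_Icc, Fin.card_Ioo, Fintype.card_fin]
  rw [Fin.lt_def] at h
  refine ⟨by simp, by simp, by omega, by omega⟩

lemma hu_fiber {n : ℕ} (f g : Fin n → Fin 4)
    (h : ∀ c, Fintype.card {x // g x = c} = Fintype.card {x // f x = c}) :
    (Finset.univ.filter fun Q : Perm (Fin n) => ∀ x, f (Q x) = g x).card =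
      ∏ c, (Fintype.card {x // f x = c}).factorial := by
  let Q0 : Perm (Fin n) := Equiv.ofFiberEquiv (f := g) (g := f) (fun c => Fintype.equivOfCardEq (h c))
  have hQ0 : ∀ x, f (Q0 x) = g x := fun x => Equiv.ofFiberEquiv_map _ x
  rw [← DomMulAct.stabilizer_card f, Fintype.card_subtype]
  refine Finset.card_bij' (fun Q _ => Q * Q0⁻¹) (fun R _ => R * Q0) ?_ ?_ ?_ ?_
  · intro Q hQ
    simp only [Finset.mem_filter, Finset.mem_univ, true_and] at hQ ⊢
    ext1 x
    simp only [Function.comp, Perm.mul_apply, hQ, ← hQ0]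
    simp
  · intro R hR
    simp only [Finset.mem_filter, Finset.mem_univ, true_and] at hR ⊢
    intro x
    rw [← hQ0]
    exact congrFun hR (Q0 x)
  · intro Q _; simp
  · intro R _; simp

open Classical in
lemma hu_count {n : ℕ} {a b v w : Fin n} (hab : b < a) (hvw : v < w)
    (h : ((w:ℕ) - v) + ((a:ℕ) - b) = n) :
    (Finset.univ.filter fun Q : Perm (Fin n) => hu_good a b Q ∧ Q a = v ∧ Q b = w).card =
      ((a:ℕ) - b - 1).factorial * (n - ((a:ℕ) - b) - 1).factorial := by
  let τ : Fin 4 → Fin 4 := ![1, 0, 3, 2]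
  have hττ : ∀ c d, τ c = d ↔ c = τ d := by decide
  have := hu_fiber (hu_col v w) (fun x => τ (hu_col b a x)) (by
    obtain ⟨a0, a1, a2, a3⟩ := hu_col_card hab
    obtain ⟨b0, b1, b2, b3⟩ := hu_col_card hvw
    intro c
    simp only [hττ]
    fin_cases c
    · exact a1.trans b0.symm
    · exact a0.trans b1.symm
    · refine a3.trans (Eq.trans ?_ b2.symm); omega
    · refine a2.trans (Eq.trans ?_ b3.symm); omega)
  obtain ⟨b0, b1, b2, b3⟩ := hu_col_card hvw
  rw [Fin.prod_univ_four, b0, b1, b2, b3] at this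
  have e1 : n - ((a:ℕ) - b) - 1 = (w:ℕ) - v - 1 := by omega
  have e2 : (a:ℕ) - b - 1 = n - ((w:ℕ) - v) - 1 := by omega
  rw [e1, e2]
  rw [mul_comm, ← one_mul (Nat.factorial ((w:ℕ) - v - 1))]
  simp only [Nat.factorial_one, one_mul] at this
  rw [one_mul, ← this]
  congr 1
  ext Q
  simp only [Finset.mem_filter, Finset.mem_univ, true_and]
  constructor
  · rintro ⟨⟨-, hg⟩, rfl, rfl⟩ x
    have hx := hg x
    by_cases xa : x = a
    · subst xa; simp [hu_col, τ, hab.ne']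
    by_cases xb : x = b
    · subst xb; simp [hu_col, τ, hvw.ne']
    have ya : Q x ≠ Q a := fun h => xa (Q.injective h)
    have yb : Q x ≠ Q b := fun h => xb (Q.injective h)
    simp only [hu_col, xa, xb, ya, yb, if_false]
    by_cases h1 : b < x ∧ x < a
    · have : ¬ (Q a < Q x ∧ Q x < Q b) := by grind
      rw [if_pos h1, if_neg this]; rfl
    · have : (Q a < Q x ∧ Q x < Q b) := by grind
      rw [if_neg h1, if_pos this]; rfl
  · intro hQ
    have ha : Q a = v := by
      have := hQ a
      simp only [hu_col, hab.ne', if_false, if_true, τ] at this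
      by_contra hc
      simp only [hc, if_false] at this
      split_ifs at this <;> simp at this
    have hb : Q b = w := by
      have := hQ b
      simp only [hu_col, if_true, τ] at this
      by_contra hc
      by_cases hc' : Q b = v
      · exact hab.ne (Q.injective (hc'.trans ha.symm))
      simp only [hc, hc', if_false] at this
      split_ifs at this <;> simp at this
    refine ⟨⟨hab, ?_⟩, ha, hb⟩
    intro x
    rw [ha, hb]
    by_cases xa : x = a
    · subst xa; rw [ha]; simp [hvw]
    by_cases xb : x = b
    · subst xb; rw [hb]; simp [hab]
    have ya : Q x ≠ v := fun h => xa (Q.injective (h.trans ha.symm))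
    have yb : Q x ≠ w := fun h => xb (Q.injective (h.trans hb.symm))
    have := hQ x
    simp only [hu_col, xa, xb, ya, yb, if_false] at this
    by_cases h1 : b < x ∧ x < a
    · rw [if_pos h1] at this
      have h2 : ¬ (v < Q x ∧ Q x < w) := by
        intro h2; rw [if_pos h2] at this; revert this; decide
      grind
    · rw [if_neg h1] at this
      have h2 : (v < Q x ∧ Q x < w) := by
        by_contra h2; rw [if_neg h2] at this; revert this; decide
      grind

lemma hu_pairs (n : ℕ) (F : ℕ → ℤ) :
    ∑ a : Fin n, ∑ b : Fin n, (if b < a then F ((a:ℕ) - b) else 0) =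
      ∑ d ∈ range n, ((n:ℤ) - 1 - d) * F (d + 1) := by
  have h1 : ∑ a : Fin n, ∑ b : Fin n, (if b < a then F ((a:ℕ) - b) else 0) =
      ∑ a ∈ range n, ∑ d ∈ range a, F (d + 1) := by
    rw [← Fin.sum_univ_eq_sum_range (fun a => ∑ d ∈ range a, F (d + 1))]
    refine Finset.sum_congr rfl fun a _ => ?_
    simp only [Fin.lt_def]
    rw [Fin.sum_univ_eq_sum_range (fun b => if b < (a:ℕ) then F ((a:ℕ) - b) else 0), ← Finset.sum_filter]
    have : (range n).filter (fun b => b < (a:ℕ)) = range a := by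
      ext x; have := a.2; simp; omega
    rw [this, ← Finset.sum_range_reflect]
    refine Finset.sum_congr rfl fun x hx => ?_
    rw [Finset.mem_range] at hx
    congr 1; omega
  rw [h1]
  clear h1
  induction n with
  | zero => simp
  | succ n ih =>
    rw [Finset.sum_range_succ, ih, Finset.sum_range_succ, ← Finset.sum_add_distrib]
    push_cast
    rw [show ((n:ℤ) + 1 - 1 - n) = 0 by ring, zero_mul, add_zero]
    refine Finset.sum_congr rfl fun x hx => ?_
    ring

open Classical in
lemma hu_total2 {n : ℕ} :
      ∑ t : Fin n × Fin n × Perm (Fin n) with hu_good t.1 t.2.1 t.2.2,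
        (-1 : ℤ) ^ ((t.1 : ℕ) - t.2.1 + 1) =
      ∑ d ∈ range (n - 1), (-1 : ℤ) ^ d * ((d + 1).factorial * (n - 1 - d).factorial) := by
  have e1 : ∀ a b : Fin n, b < a →
      ((Finset.univ.filter fun Q : Perm (Fin n) => hu_good a b Q).card : ℤ) =
      ((a:ℕ) - b : ℕ) * (((a:ℕ) - b - 1).factorial * (n - ((a:ℕ) - b) - 1).factorial) := by
    intro a b hab
    have h1 : ((Finset.univ.filter fun Q : Perm (Fin n) => hu_good a b Q).card : ℤ) =
      ∑ w : Fin n, ∑ v : Fin n,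
        ((Finset.univ.filter fun Q : Perm (Fin n) => hu_good a b Q ∧ Q a = v ∧ Q b = w).card : ℤ) := by
      rw [Finset.card_eq_sum_card_fiberwise (f := fun Q : Perm (Fin n) => (Q b, Q a)) (t := Finset.univ)
        (by intro _ _; simp)]
      rw [Fintype.sum_prod_type]
      push_cast
      refine Finset.sum_congr rfl fun w _ => Finset.sum_congr rfl fun v _ => ?_
      rw [Finset.filter_filter]
      congr 3
      ext Q
      simp [and_comm]
    have h2 : ∀ w v : Fin n,
        ((Finset.univ.filter fun Q : Perm (Fin n) => hu_good a b Q ∧ Q a = v ∧ Q b = w).card : ℤ) =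
        if v < w then (if ((w:ℕ) - v) + ((a:ℕ) - b) = n then
          (((a:ℕ) - b - 1).factorial * (n - ((a:ℕ) - b) - 1).factorial : ℤ) else 0) else 0 := by
      intro w v
      split_ifs with h3 h4
      · rw [hu_count hab h3 h4]; push_cast; rfl
      · rw [Nat.cast_eq_zero, Finset.card_eq_zero, Finset.filter_eq_empty_iff]
        rintro Q - ⟨hg, rfl, rfl⟩
        exact h4 (hu_good_card hg).2
      · rw [Nat.cast_eq_zero, Finset.card_eq_zero, Finset.filter_eq_empty_iff]
        rintro Q - ⟨hg, rfl, rfl⟩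
        exact h3 (hu_good_card hg).1
    rw [h1]
    simp only [h2]
    rw [hu_pairs n (fun e => if e + ((a:ℕ) - b) = n then
          (((a:ℕ) - b - 1).factorial * (n - ((a:ℕ) - b) - 1).factorial : ℤ) else 0)]
    rw [Fin.lt_def] at hab
    have := a.2
    rw [Finset.sum_eq_single (n - 1 - ((a:ℕ) - b))]
    · rw [if_pos (by omega)]
      congr 1
      omega
    · intro d _ hd
      rw [if_neg (by omega), mul_zero]
    · intro h; exfalso; apply h; rw [Finset.mem_range]; omega
  have e2 : ∑ t : Fin n × Fin n × Perm (Fin n) with hu_good t.1 t.2.1 t.2.2,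
        (-1 : ℤ) ^ ((t.1 : ℕ) - t.2.1 + 1) =
      ∑ a : Fin n, ∑ b : Fin n, (if b < a then (fun d : ℕ => (-1 : ℤ) ^ (d + 1) *
        (d * ((d - 1).factorial * (n - d - 1).factorial))) ((a:ℕ) - b) else 0) := by
    rw [Finset.sum_filter, Fintype.sum_prod_type]
    refine Finset.sum_congr rfl fun a _ => ?_
    rw [Fintype.sum_prod_type]
    refine Finset.sum_congr rfl fun b _ => ?_
    simp only
    rw [← Finset.sum_filter, Finset.sum_const]
    split_ifs with h
    · rw [nsmul_eq_mul, e1 a b h, mul_comm]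
    · have : (Finset.univ.filter fun Q : Perm (Fin n) => hu_good a b Q) = ∅ := by
        rw [Finset.filter_eq_empty_iff]
        rintro Q - hg
        exact h hg.1
      rw [this]; simp
  rw [e2]
  refine (hu_pairs n (fun d : ℕ => (-1 : ℤ) ^ (d + 1) *
        (d * ((d - 1).factorial * (n - d - 1).factorial)))).trans ?_
  cases n with
  | zero => simp
  | succ n =>
    rw [Finset.sum_range_succ]
    push_cast
    rw [show ((n:ℤ) + 1 - 1 - n) = 0 by ring, zero_mul, add_zero]
    refine Finset.sum_congr (by simp) fun d hd => ?_
    rw [Finset.mem_range] at hd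
    obtain ⟨m, rfl⟩ : ∃ m, n = d + 1 + m := ⟨n - d - 1, by omega⟩
    have k1 : d + 1 + m - d - 1 = m := by omega
    have k2 : d + 1 + m - d = m + 1 := by omega
    rw [k1, k2, Nat.factorial_succ d, Nat.factorial_succ m]
    push_cast
    ring

lemma hu_tele (n m : ℕ) (h : m ≤ n) :
    ((n:ℤ) + 2) * ∑ d ∈ range m, (-1 : ℤ) ^ d * ((d + 1).factorial * (n - 1 - d).factorial) =
      n.factorial - (-1) ^ m * ((m+1).factorial * (n - m).factorial) := by
  induction m with
  | zero => simp
  | succ m ih =>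
    rw [Finset.sum_range_succ, mul_add, ih (by omega)]
    obtain ⟨k, rfl⟩ : ∃ k, n = m + 1 + k := ⟨n - m - 1, by omega⟩
    have k1 : m + 1 + k - m = k + 1 := by omega
    have k2 : m + 1 + k - 1 - m = k := by omega
    have k3 : m + 1 + k - (m + 1) = k := by omega
    rw [k1, k2, k3, Nat.factorial_succ (m+1), Nat.factorial_succ k]
    push_cast
    ring

/-- `(g+1) H(2g, 1) = (2g)!`: the number of permutations of `S_{2g}` whose cycle graph
has exactly one alternating cycle is `(2g)!/(g+1)` (the lowest coefficient `a_{g,2g}` of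
`P_g(X) = (1-X)^{4g+1} H_g(X)`). -/
theorem hultman_one_cycle (g : ℕ) (hg : 1 ≤ g) :
    (g + 1) * H (2 * g) 1 = Nat.factorial (2 * g) := by
  have h1 := hu_H (n := 2 * g) (even_two_mul g)
  rw [hu_total (even_two_mul g) (by omega), hu_total2] at h1
  have h2 := hu_tele (2 * g) (2 * g - 1) (by omega)
  rw [← h1] at h2
  have h3 : 2 * g - (2 * g - 1) = 1 := by omega
  have h4 : 2 * g - 1 + 1 = 2 * g := by omega
  have h5 : Odd (2 * g - 1) := ⟨g - 1, by omega⟩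
  rw [h3, h4, h5.neg_one_pow, Nat.factorial_one] at h2
  push_cast at h2
  zify
  linarith
end
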